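/- Suppose (Poly-R₁) holds with β₂<1, Φ(r) ≃ Ψ(r) for r∈(0,R₁), and HK^h_B holds. Then for every T>0 there exists C≥1 such that for all (t,x,y)∈(0,T]×D×D with ψ(ρ(x,y)) ≥ t, writing r:=ρ(x,y): if C₀=0 then C^{−1} t h(Φ(r),x,y)/(V(x,r)ψ(r)) ≤ q(t,x,y) ≤ C t h(Φ(r),x,y)/(V(x,r)ψ(r)), and if C₀=1 then C^{−1} t 𝔅_h(t,x,y)/(V(x,r)Φ(r)) ≤ q(t,x,y) ≤ C t 𝔅_h(t,x,y)/(V(x,r)Φ(r)), where 𝔅_h(t,x,y):=∫_{2/φ^{−1}(1/t)}^{4Φ(r)} h(s,x,y)w(s)ds and ψ(r):=1/φ(1/Φ(r)). -/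

import Mathlib

open MeasureTheory Real Set
open scoped ENNReal

/-- Tail of the Lévy measure: `w(r) = ν((r,∞))`. -/
noncomputable def levyTail (ν : Measure ℝ) (r : ℝ) : ℝ := (ν (Set.Ioi r)).toReal

/-- Laplace exponent `φ(λ) = ∫ (1 - e^{-λ s}) ν(ds)`. -/
noncomputable def laplaceExp (ν : Measure ℝ) (lam : ℝ) : ℝ :=
  ∫ s, (1 - Real.exp (-(lam * s))) ∂ν

/-- Condition (Poly-R₁); (Poly-∞) is the case `R₁ = ⊤`. -/
def PolyCond (ν : Measure ℝ) (R₁ : ℝ≥0∞) (c c' β₁ β₂ : ℝ) : Prop :=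
  ∀ r R : ℝ, 0 < r → r ≤ R → ENNReal.ofReal R < R₁ →
    c * (R / r) ^ β₁ ≤ levyTail ν r / levyTail ν R ∧
      levyTail ν r / levyTail ν R ≤ c' * (R / r) ^ β₂

/-- `ν` is the Lévy measure of a driftless subordinator. -/
structure IsLevyMeasure (ν : Measure ℝ) : Prop where
  supp : ν (Set.Iic 0) = 0
  tail_fin : ∀ r : ℝ, 0 < r → ν (Set.Ioi r) < ⊤
  integ : IntegrableOn (fun s => s) (Set.Ioc (0:ℝ) 1) ν

/-- `μ t` is the law of `S_t` for the driftless subordinator with Lévy measure `ν`. -/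
structure IsSubordinatorLaw (ν : Measure ℝ) (μ : ℝ → Measure ℝ) : Prop where
  levy : IsLevyMeasure ν
  prob : ∀ t : ℝ, 0 < t → IsProbabilityMeasure (μ t)
  nonneg : ∀ t : ℝ, 0 < t → μ t (Set.Iio 0) = 0
  laplace : ∀ t lam : ℝ, 0 < t → 0 ≤ lam →
    (∫ s, Real.exp (-(lam * s)) ∂(μ t)) = Real.exp (-(t * laplaceExp ν lam))

/-- `H(λ) = φ(λ) - λ φ'(λ)`. -/
noncomputable def Hfun (ν : Measure ℝ) (lam : ℝ) : ℝ :=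
  laplaceExp ν lam - lam * deriv (laplaceExp ν) lam

/-- `σ(t,s) = (φ')⁻¹(s/t)` if `s/t < φ'(0+)`, and `σ(t,s) = 0` otherwise. -/
def IsSigmaFun (ν : Measure ℝ) (σ : ℝ → ℝ → ℝ) : Prop :=
  ∀ t s : ℝ, 0 < t → 0 < s →
    ((∃ lam : ℝ, 0 < lam ∧ s / t < deriv (laplaceExp ν) lam) →
      0 < σ t s ∧ deriv (laplaceExp ν) (σ t s) = s / t) ∧
    ((∀ lam : ℝ, 0 < lam → deriv (laplaceExp ν) lam ≤ s / t) → σ t s = 0)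

/-- `φInv` is the inverse of the Laplace exponent `φ` on `(0,∞)`. -/
def IsPhiInv (ν : Measure ℝ) (φInv : ℝ → ℝ) : Prop :=
  ∀ u : ℝ, 0 < u → 0 < φInv u ∧ laplaceExp ν (φInv u) = u

/-- `HInv` is the inverse of `H` on `(0,∞)`. -/
def IsHInv (ν : Measure ℝ) (HInv : ℝ → ℝ) : Prop :=
  ∀ u : ℝ, 0 < u → 0 < HInv u ∧ Hfun ν (HInv u) = u


/-- `V(x,r) = m(B(x,r))`. -/
noncomputable def vol {E : Type*} [PseudoMetricSpace E] [MeasurableSpace E] (m : Measure E) (x : E) (r : ℝ) : ℝ :=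
  (m (Metric.ball x r)).toReal

/-- Volume doubling and reverse doubling with exponents `d₁ ≤ d₂` and
localization radius `R_E`. -/
def VolDoubling {E : Type*} [PseudoMetricSpace E] [MeasurableSpace E] (m : Measure E) (R_E : ℝ≥0∞)
    (d₁ d₂ : ℝ) : Prop :=
  ∀ a : ℝ, 1 ≤ a → ∃ CV : ℝ, 1 ≤ CV ∧ ∀ (x : E) (r R : ℝ), 0 < r → r ≤ R →
    ENNReal.ofReal R < ENNReal.ofReal a * R_E →
    CV⁻¹ * (R / r) ^ d₁ ≤ vol m x R / vol m x r ∧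
      vol m x R / vol m x r ≤ CV * (R / r) ^ d₂

/-- Global weak scaling condition with indices `α₁ ≤ α₂`. -/
def WeakScaling (Φ : ℝ → ℝ) (c c' α₁ α₂ : ℝ) : Prop :=
  ∀ r R : ℝ, 0 < r → r ≤ R →
    c * (R / r) ^ α₁ ≤ Φ R / Φ r ∧ Φ R / Φ r ≤ c' * (R / r) ^ α₂

/-- `h` is a boundary function on `D`: it takes values in `[0,1]`, satisfies (H1)
(non-increasing in time) and (H2) with constant `cH` and exponent `γ` below the
time horizon `T` (`T = ⊤` for unbounded `D`). -/
def IsBoundaryFunction {E : Type*} (D : Set E) (h : ℝ → E → E → ℝ) (T : ℝ≥0∞)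
    (cH γ : ℝ) : Prop :=
  (∀ (t : ℝ) (x y : E), 0 < t → x ∈ D → y ∈ D → h t x y ∈ Set.Icc (0:ℝ) 1) ∧
  (∀ (x y : E), x ∈ D → y ∈ D → ∀ s t : ℝ, 0 < s → s ≤ t → h t x y ≤ h s x y) ∧
  (∀ (x y : E), x ∈ D → y ∈ D → ∀ s t : ℝ, 0 < s → s ≤ t → ENNReal.ofReal t < T →
    s ^ γ * h s x y ≤ cH * (t ^ γ * h t x y))

/-- Two-sided estimate (3.4) for the heat kernel `p_D` of `Y^D`, holding for all times
`t` with `0 < t` satisfying `tcond t`. -/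
def HKest {E : Type*} [PseudoMetricSpace E] [MeasurableSpace E] (m : Measure E) (D : Set E)
    (Ψ ΦInv : ℝ → ℝ) (h pD : ℝ → E → E → ℝ)
    (C₀ cl cexl cu cexu : ℝ) (tcond : ℝ → Prop) : Prop :=
  ∀ (t : ℝ) (x y : E), 0 < t → tcond t → x ∈ D → y ∈ D →
    cl * h t x y * min ((vol m x (ΦInv t))⁻¹)
        (C₀ * t / (vol m x (dist x y) * Ψ (dist x y)) +
          (vol m x (ΦInv t))⁻¹ * Real.exp (-(cexl * dist x y ^ 2 / ΦInv t ^ 2)))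
      ≤ pD t x y ∧
    pD t x y ≤ cu * h t x y * min ((vol m x (ΦInv t))⁻¹)
        (C₀ * t / (vol m x (dist x y) * Ψ (dist x y)) +
          (vol m x (ΦInv t))⁻¹ * Real.exp (-(cexu * dist x y ^ 2 / ΦInv t ^ 2)))

/-- Large-time estimate (3.5): `p_D(t,x,y) ≍ e^{-λ_D t} h(1,x,y)` for `t ≥ 1`. -/
def HKlarge {E : Type*} (D : Set E) (h pD : ℝ → E → E → ℝ) (lamD c₅ c₆ : ℝ) : Prop :=
  ∀ (t : ℝ) (x y : E), 1 ≤ t → x ∈ D → y ∈ D →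
    c₅ * Real.exp (-(lamD * t)) * h 1 x y ≤ pD t x y ∧
      pD t x y ≤ c₆ * Real.exp (-(lamD * t)) * h 1 x y

/-- Heat kernel `q(t,x,y) = ∫ p_D(s,x,y) P(S_t ∈ ds)` of the subordinate process. -/
noncomputable def subq {E : Type*} (μ : ℝ → Measure ℝ) (pD : ℝ → E → E → ℝ)
    (t : ℝ) (x y : E) : ℝ :=
  ∫ s, pD s x y ∂(μ t)

/-- Jump kernel `J(x,y) = ∫ p_D(s,x,y) ν(ds)` of the subordinate process. -/
noncomputable def subJ {E : Type*} (ν : Measure ℝ) (pD : ℝ → E → E → ℝ) (x y : E) : ℝ :=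
  ∫ s, pD s x y ∂ν

/-- Green function `G_D(x,y) = ∫_0^∞ q(t,x,y) dt` of the subordinate process. -/
noncomputable def subG {E : Type*} (μ : ℝ → Measure ℝ) (pD : ℝ → E → E → ℝ)
    (x y : E) : ℝ :=
  ∫ t in Set.Ioi (0:ℝ), subq μ pD t x y

/-- `ψ(r) = 1/φ(1/Φ(r))`. -/
noncomputable def psiFun (ν : Measure ℝ) (Φ : ℝ → ℝ) (r : ℝ) : ℝ :=
  (laplaceExp ν ((Φ r)⁻¹))⁻¹

/-- `𝔅_h(t,x,y) = ∫_{2/φ⁻¹(1/t)}^{4Φ(ρ(x,y))} h(s,x,y) w(s) ds`. -/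
noncomputable def sB {E : Type*} [PseudoMetricSpace E] [MeasurableSpace E] (ν : Measure ℝ)
    (h : ℝ → E → E → ℝ) (Φ φInv : ℝ → ℝ) (t : ℝ) (x y : E) : ℝ :=
  ∫ s in Set.Ioc (2 * (φInv (t⁻¹))⁻¹) (4 * Φ (dist x y)), h s x y * levyTail ν s

/-- Hypotheses of case (1): (Poly-R₁) holds and `HK^h_B` holds. -/
def BddCaseHyp {E : Type*} [PseudoMetricSpace E] [MeasurableSpace E] (m : Measure E) (D : Set E)
    (Φ Ψ ΦInv : ℝ → ℝ) (h pD : ℝ → E → E → ℝ) (ν : Measure ℝ)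
    (R₁ : ℝ≥0∞) (cw cw' β₁ β₂ cH γ C₀ cl cexl cu cexu : ℝ) : Prop :=
  PolyCond ν R₁ cw cw' β₁ β₂ ∧
  Bornology.IsBounded D ∧
  ENNReal.ofReal (8 * Φ (Metric.diam D)) < R₁ ∧
  IsBoundaryFunction D h (ENNReal.ofReal (4 * Φ (Metric.diam D) + 1)) cH γ ∧
  HKest m D Ψ ΦInv h pD C₀ cl cexl cu cexu (fun t => t ≤ 1) ∧
  ∃ lamD c₅ c₆ : ℝ, 0 < lamD ∧ 0 < c₅ ∧ 0 < c₆ ∧ HKlarge D h pD lamD c₅ c₆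

/-- Hypotheses of case (2): (Poly-∞) holds and `HK^h_U` holds (with `R_E = ⊤`). -/
def UnbddCaseHyp {E : Type*} [PseudoMetricSpace E] [MeasurableSpace E] (m : Measure E) (D : Set E)
    (Ψ ΦInv : ℝ → ℝ) (h pD : ℝ → E → E → ℝ) (ν : Measure ℝ)
    (R_E : ℝ≥0∞) (cw cw' β₁ β₂ cH γ C₀ cl cexl cu cexu : ℝ) : Prop :=
  PolyCond ν ⊤ cw cw' β₁ β₂ ∧
  R_E = ⊤ ∧
  IsBoundaryFunction D h ⊤ cH γ ∧
  HKest m D Ψ ΦInv h pD C₀ cl cexl cu cexu (fun _ => True)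

/-- On-diagonal expression `h(1/φ⁻¹(1/t),x,y) / V(x, ψ⁻¹(t))`. -/
noncomputable def onDiag {E : Type*} [PseudoMetricSpace E] [MeasurableSpace E] (m : Measure E)
    (h : ℝ → E → E → ℝ) (ΦInv φInv : ℝ → ℝ) (t : ℝ) (x y : E) : ℝ :=
  h ((φInv (t⁻¹))⁻¹) x y / vol m x (ΦInv ((φInv (t⁻¹))⁻¹))

/-- Off-diagonal expression in Theorem 4.2(ii), with constant `c` in the exponential. -/
noncomputable def offDiag {E : Type*} [PseudoMetricSpace E] [MeasurableSpace E] (ν : Measure ℝ)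
    (m : Measure E) (h : ℝ → E → E → ℝ) (Φ Ψ ΦInv φInv : ℝ → ℝ)
    (C₀ c t : ℝ) (x y : E) : ℝ :=
  C₀ / (vol m x (dist x y) * Ψ (dist x y)) *
      (t * sB ν h Φ φInv t x y + h ((φInv (t⁻¹))⁻¹) x y / φInv (t⁻¹)) +
    h ((φInv (t⁻¹))⁻¹) x y / vol m x (ΦInv ((φInv (t⁻¹))⁻¹)) *
      Real.exp (-(c * dist x y ^ 2 / ΦInv ((φInv (t⁻¹))⁻¹) ^ 2)) +
    h (Φ (dist x y)) x y * (t * levyTail ν (Φ (dist x y))) / vol m x (dist x y)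


open MeasureTheory Real Set
open scoped ENNReal

lemma min_le_two_exp {x : ℝ} (hx : 0 ≤ x) : min 1 x ≤ 2 * (1 - Real.exp (-x)) := by
  have h1 : Real.exp (-x) ≤ 1 / (1 + x) := by
    rw [Real.exp_neg, ← one_div]
    apply one_div_le_one_div_of_le (by linarith)
    linarith [Real.add_one_le_exp x]
  have h2 : 1 - 1/(1+x) = x/(1+x) := by field_simp; ring
  have h3 : min 1 x ≤ 2 * (x/(1+x)) := by
    rw [← mul_div_assoc, le_div_iff₀ (by linarith)]
    rcases le_total 1 x with h | h
    · rw [min_eq_left h]; linarith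
    · rw [min_eq_right h]; nlinarith
  linarith

lemma one_sub_exp_le_min (x : ℝ) : 1 - Real.exp (-x) ≤ min 1 x := by
  apply le_min
  · linarith [Real.exp_pos (-x)]
  · linarith [Real.add_one_le_exp (-x)]


lemma levy_ae_pos {ν : Measure ℝ} (hν : IsLevyMeasure ν) : ∀ᵐ s ∂ν, 0 < s := by
  rw [ae_iff]
  have : {a : ℝ | ¬ 0 < a} = Set.Iic 0 := by ext; simp
  rw [this]; exact hν.supp

lemma lap_integrable {ν : Measure ℝ} (hν : IsLevyMeasure ν) {l : ℝ} (hl : 0 ≤ l) :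
    Integrable (fun s => 1 - Real.exp (-(l * s))) ν := by
  have hmeas : Measurable (fun s : ℝ => 1 - Real.exp (-(l * s))) := by fun_prop
  rw [← integrableOn_univ]
  have : (Set.univ : Set ℝ) = Set.Iic 0 ∪ (Set.Ioc 0 1 ∪ Set.Ioi 1) := by
    rw [Set.Ioc_union_Ioi_eq_Ioi (by norm_num), Set.Iic_union_Ioi]
  rw [this]
  refine IntegrableOn.union ?_ (IntegrableOn.union ?_ ?_)
  · rw [IntegrableOn, Measure.restrict_eq_zero.2 hν.supp]; exact integrable_zero_measure
  · refine Integrable.mono' (hν.integ.const_mul l) hmeas.aestronglyMeasurable ?_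
    filter_upwards [ae_restrict_mem measurableSet_Ioc] with s hs
    have h0 : 0 ≤ l * s := mul_nonneg hl hs.1.le
    rw [Real.norm_of_nonneg (by linarith [Real.exp_le_one_iff.2 (neg_nonpos.2 h0)])]
    exact (one_sub_exp_le_min _).trans (min_le_right _ _)
  · refine Measure.integrableOn_of_bounded (M := 1) (hν.tail_fin 1 one_pos).ne
      hmeas.aestronglyMeasurable ?_
    filter_upwards [ae_restrict_mem measurableSet_Ioi] with s hs
    have h0 : 0 ≤ l * s := mul_nonneg hl (le_trans zero_le_one (le_of_lt hs))
    rw [Real.norm_of_nonneg (by linarith [Real.exp_le_one_iff.2 (neg_nonpos.2 h0)])]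
    exact (one_sub_exp_le_min _).trans (min_le_left _ _)

lemma lap_mono {ν : Measure ℝ} (hν : IsLevyMeasure ν) {l l' : ℝ} (hl : 0 ≤ l) (hll : l ≤ l') : laplaceExp ν l ≤ laplaceExp ν l' := by
  refine integral_mono_ae (lap_integrable hν hl) (lap_integrable hν (hl.trans hll)) ?_
  filter_upwards [levy_ae_pos hν] with s hs
  have : l * s ≤ l' * s := by gcongr
  have := Real.exp_le_exp.2 (neg_le_neg this)
  show 1 - Real.exp (-(l*s)) ≤ 1 - Real.exp (-(l'*s))
  linarith

lemma lap_two {ν : Measure ℝ} (hν : IsLevyMeasure ν) {l : ℝ} (hl : 0 ≤ l) : laplaceExp ν (2 * l) ≤ 2 * laplaceExp ν l := by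
  unfold laplaceExp
  rw [← integral_const_mul]
  refine integral_mono_ae (lap_integrable hν (by positivity)) ((lap_integrable hν hl).const_mul 2) ?_
  filter_upwards [levy_ae_pos hν] with s hs
  have : Real.exp (-(2 * l * s)) = Real.exp (-(l*s)) ^ 2 := by
    rw [← Real.exp_nat_mul]; congr 1; push_cast; ring
  simp only [this]
  nlinarith [sq_nonneg (1 - Real.exp (-(l*s)))]

lemma tail_anti {ν : Measure ℝ} (hν : IsLevyMeasure ν) {r R : ℝ} (hr : 0 < r) (h : r ≤ R) : levyTail ν R ≤ levyTail ν r :=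
  ENNReal.toReal_mono (hν.tail_fin r hr).ne (measure_mono (Set.Ioi_subset_Ioi h))

lemma tail_nonneg {ν : Measure ℝ} (r : ℝ) : 0 ≤ levyTail ν r := ENNReal.toReal_nonneg

lemma lap_ge_tail {ν : Measure ℝ} (hν : IsLevyMeasure ν) {R : ℝ} (hR : 0 < R) : levyTail ν R ≤ 2 * laplaceExp ν R⁻¹ := by
  have h1 : levyTail ν R = ∫ s, (Set.Ioi R).indicator 1 s ∂ν := by
    rw [integral_indicator_one measurableSet_Ioi]; rfl
  rw [h1]; unfold laplaceExp
  rw [← integral_const_mul]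
  refine integral_mono_ae ?_ ((lap_integrable hν (by positivity)).const_mul 2) ?_
  · exact (integrable_indicator_iff measurableSet_Ioi).2
      (integrableOn_const (hν.tail_fin R hR).ne)
  · filter_upwards [levy_ae_pos hν] with s hs
    have h0 : 0 ≤ R⁻¹ * s := by positivity
    have := min_le_two_exp h0
    by_cases hsR : R < s
    · rw [Set.indicator_of_mem (by exact hsR)]
      have : min 1 (R⁻¹ * s) = 1 := by
        apply min_eq_left
        rw [inv_mul_eq_div, le_div_iff₀ hR]; linarith
      simp only [Pi.one_apply]; linarith
    · rw [Set.indicator_of_notMem (by simpa using hsR)]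
      have : 0 ≤ min 1 (R⁻¹ * s) := le_min zero_le_one h0
      linarith


lemma poly_pos {ν : Measure ℝ} {R₁ : ℝ≥0∞} {c c' β₁ β₂ : ℝ} (hc : 0 < c)
    (hp : PolyCond ν R₁ c c' β₁ β₂) {R : ℝ} (hR : 0 < R) (hRR : ENNReal.ofReal R < R₁) :
    0 < levyTail ν R := by
  have h := (hp R R hR le_rfl hRR).1
  rw [div_self hR.ne', Real.one_rpow, mul_one] at h
  rcases (tail_nonneg R : 0 ≤ levyTail ν R).eq_or_lt with h0 | h0
  · rw [← h0] at h; simp at h; linarith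
  · exact h0

lemma poly_up {ν : Measure ℝ} {R₁ : ℝ≥0∞} {c c' β₁ β₂ : ℝ} (hc : 0 < c)
    (hp : PolyCond ν R₁ c c' β₁ β₂) {r R : ℝ} (hr : 0 < r) (hrR : r ≤ R)
    (hRR : ENNReal.ofReal R < R₁) :
    levyTail ν r ≤ c' * (R / r) ^ β₂ * levyTail ν R := by
  have h := (hp r R hr hrR hRR).2
  rwa [div_le_iff₀ (poly_pos hc hp (hr.trans_le hrR) hRR)] at h

lemma poly_low {ν : Measure ℝ} {R₁ : ℝ≥0∞} {c c' β₁ β₂ : ℝ} (hc : 0 < c)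
    (hp : PolyCond ν R₁ c c' β₁ β₂) {r R : ℝ} (hr : 0 < r) (hrR : r ≤ R)
    (hRR : ENNReal.ofReal R < R₁) :
    c * (R / r) ^ β₁ * levyTail ν R ≤ levyTail ν r := by
  have h := (hp r R hr hrR hRR).1
  rwa [le_div_iff₀ (poly_pos hc hp (hr.trans_le hrR) hRR)] at h

lemma lap_le_tail {ν : Measure ℝ} (hν : IsLevyMeasure ν) {R₁ : ℝ≥0∞} {c c' β₁ β₂ : ℝ}
    (hc : 0 < c) (hc' : 0 < c') (hβ₂0 : 0 < β₂) (hβ₂ : β₂ < 1)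
    (hp : PolyCond ν R₁ c c' β₁ β₂) {R : ℝ} (hR : 0 < R) (hRR : ENNReal.ofReal R < R₁) :
    laplaceExp ν R⁻¹ ≤ c' / (1 - β₂) * levyTail ν R := by
  have hw := poly_pos hc hp hR hRR
  have hK : 0 ≤ c' / (1 - β₂) * levyTail ν R :=
    mul_nonneg (div_nonneg hc'.le (by linarith)) hw.le
  unfold laplaceExp
  rw [integral_eq_lintegral_of_nonneg_ae]
  rotate_left
  · filter_upwards [levy_ae_pos hν] with s hs
    have h0 : 0 ≤ R⁻¹ * s := by positivity
    simpa using h0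
  · exact (by fun_prop : Measurable (fun s : ℝ => 1 - Real.exp (-(R⁻¹ * s)))).aestronglyMeasurable
  apply ENNReal.toReal_le_of_le_ofReal hK
  have step1 : ∫⁻ s, ENNReal.ofReal (1 - Real.exp (-(R⁻¹ * s))) ∂ν ≤
      ∫⁻ s, ENNReal.ofReal (min 1 (R⁻¹ * s)) ∂ν :=
    lintegral_mono fun s => ENNReal.ofReal_le_ofReal (one_sub_exp_le_min _)
  refine step1.trans ?_
  rw [lintegral_eq_lintegral_meas_lt ν (by
      filter_upwards [levy_ae_pos hν] with s hs
      exact le_min zero_le_one (by positivity)) (by fun_prop)]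
  have hint : IntegrableOn (fun t : ℝ => c' * levyTail ν R * t ^ (-β₂)) (Set.Ioc 0 1) := by
    apply Integrable.const_mul
    have := (intervalIntegral.intervalIntegrable_rpow' (a := 0) (b := 1) (r := -β₂) (by linarith))
    rwa [intervalIntegrable_iff_integrableOn_Ioc_of_le zero_le_one] at this
  have step2 : ∫⁻ t in Set.Ioi (0:ℝ), ν {a | t < min 1 (R⁻¹ * a)} ≤
      ∫⁻ t in Set.Ioc (0:ℝ) 1, ENNReal.ofReal (c' * levyTail ν R * t ^ (-β₂)) := by
    rw [← lintegral_indicator measurableSet_Ioi, ← lintegral_indicator measurableSet_Ioc]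
    apply lintegral_mono
    intro t
    by_cases ht : 0 < t
    swap
    · simp [Set.indicator, ht]
    by_cases ht1 : t < 1
    · rw [Set.indicator_of_mem (by exact ht), Set.indicator_of_mem (by exact ⟨ht, ht1.le⟩)]
      have hset : {a | t < min 1 (R⁻¹ * a)} = Set.Ioi (t * R) := by
        ext a
        simp only [Set.mem_ofPred_eq, lt_min_iff, ht1, true_and, Set.mem_Ioi]
        rw [inv_mul_eq_div, lt_div_iff₀ hR]
      rw [hset]
      have htR : 0 < t * R := by positivity
      rw [← ENNReal.ofReal_toReal (hν.tail_fin _ htR).ne]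
      apply ENNReal.ofReal_le_ofReal
      have := poly_up hc hp htR (by nlinarith : t * R ≤ R) hRR
      have e : R / (t * R) = t⁻¹ := by field_simp
      rw [e, Real.inv_rpow ht.le, ← Real.rpow_neg ht.le] at this
      unfold levyTail at this ⊢
      linarith
    · have hset : {a | t < min 1 (R⁻¹ * a)} = ∅ := by
        ext a
        simp only [Set.mem_ofPred_eq, lt_min_iff, ht1, false_and, Set.mem_empty_iff_false]
      rw [Set.indicator_of_mem (by exact ht), hset]; simp
  refine step2.trans ?_
  rw [← ofReal_integral_eq_lintegral_ofReal hint (by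
    filter_upwards [ae_restrict_mem measurableSet_Ioc] with t ht
    have := ht.1
    positivity)]
  apply ENNReal.ofReal_le_ofReal
  rw [integral_const_mul, ← intervalIntegral.integral_of_le zero_le_one,
    integral_rpow (Or.inl (by linarith))]
  rw [Real.zero_rpow (by linarith), Real.one_rpow]
  apply le_of_eq
  have : (1 - β₂) ≠ 0 := by linarith
  have : (-β₂ + 1) ≠ 0 := by linarith
  field_simp
  ring

open MeasureTheory Real Set
open scoped ENNReal


lemma sub_ae_nonneg {ν : Measure ℝ} {μ : ℝ → Measure ℝ} (hsub : IsSubordinatorLaw ν μ) {t : ℝ} (ht : 0 < t) : ∀ᵐ s ∂(μ t), 0 ≤ s := by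
  rw [ae_iff]
  have : {a : ℝ | ¬ 0 ≤ a} = Set.Iio 0 := by ext; simp
  rw [this]; exact hsub.nonneg t ht

lemma sub_exp_integrable {ν : Measure ℝ} {μ : ℝ → Measure ℝ} (hsub : IsSubordinatorLaw ν μ) {t l : ℝ} (ht : 0 < t) (hl : 0 ≤ l) :
    Integrable (fun s => Real.exp (-(l * s))) (μ t) := by
  have := hsub.prob t ht
  refine Integrable.of_bound (by fun_prop) 1 ?_
  filter_upwards [sub_ae_nonneg hsub ht] with s hs
  rw [Real.norm_of_nonneg (Real.exp_pos _).le, Real.exp_le_one_iff]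
  have : 0 ≤ l * s := by positivity
  linarith

lemma sub_ae_pos {ν : Measure ℝ} {μ : ℝ → Measure ℝ} (hsub : IsSubordinatorLaw ν μ) {φInv : ℝ → ℝ} (hφ : IsPhiInv ν φInv) {t : ℝ} (ht : 0 < t) :
    ∀ᵐ s ∂(μ t), 0 < s := by
  have := hsub.prob t ht
  have key : ∀ u : ℝ, 0 < u → (μ t).real {0} ≤ Real.exp (-(t * u)) := by
    intro u hu
    have h1 := hsub.laplace t (φInv u) ht (hφ u hu).1.le
    rw [(hφ u hu).2] at h1
    rw [← h1, ← integral_indicator_one (measurableSet_singleton _)]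
    refine integral_mono ?_ (sub_exp_integrable hsub ht (hφ u hu).1.le) ?_
    · exact (integrable_indicator_iff (measurableSet_singleton _)).2
        (integrableOn_const (measure_ne_top _ _))
    · intro s
      by_cases hs : s = 0
      · subst hs; simp
      · rw [Set.indicator_of_notMem (by simpa using hs)]; positivity
  have h0 : (μ t).real {0} = 0 := by
    apply le_antisymm _ measureReal_nonneg
    have hl : Filter.Tendsto (fun u : ℝ => Real.exp (-(t * u))) Filter.atTop (nhds 0) :=
      Real.tendsto_exp_neg_atTop_nhds_zero.comp (Filter.tendsto_id.const_mul_atTop ht)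
    refine ge_of_tendsto hl ?_
    filter_upwards [Filter.eventually_gt_atTop 0] with u hu using key u hu
  have h1 : ∀ᵐ s ∂(μ t), s ≠ 0 := by
    rw [ae_iff]
    have : {a : ℝ | ¬ a ≠ 0} = {0} := by ext; simp
    rw [this]
    exact (measureReal_eq_zero_iff).1 h0
  filter_upwards [h1, sub_ae_nonneg hsub ht] with s h1 h2
  exact lt_of_le_of_ne h2 h1.symm

lemma sub_min_integrable {ν : Measure ℝ} {μ : ℝ → Measure ℝ} (hsub : IsSubordinatorLaw ν μ) {t u : ℝ} (ht : 0 < t) (hu : 0 < u) :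
    Integrable (fun s => min 1 (s / u)) (μ t) := by
  have := hsub.prob t ht
  refine Integrable.of_bound (by fun_prop) 1 ?_
  filter_upwards [sub_ae_nonneg hsub ht] with s hs
  rw [Real.norm_of_nonneg (le_min zero_le_one (by positivity))]
  exact min_le_left _ _

lemma lap_nonneg {ν : Measure ℝ} {μ : ℝ → Measure ℝ} (hsub : IsSubordinatorLaw ν μ) {l : ℝ} (hl : 0 ≤ l) : 0 ≤ laplaceExp ν l := by
  refine integral_nonneg_of_ae ?_
  filter_upwards [levy_ae_pos hsub.levy] with s hs
  have h0 : 0 ≤ l * s := by positivity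
  simpa using h0

lemma sub_min_le {ν : Measure ℝ} {μ : ℝ → Measure ℝ} (hsub : IsSubordinatorLaw ν μ) {t u : ℝ} (ht : 0 < t) (hu : 0 < u) :
    ∫ s, min 1 (s / u) ∂(μ t) ≤ 2 * (t * laplaceExp ν u⁻¹) := by
  have := hsub.prob t ht
  have hu' : 0 ≤ u⁻¹ := by positivity
  have h1 : ∫ s, min 1 (s / u) ∂(μ t) ≤ ∫ s, 2 * (1 - Real.exp (-(u⁻¹ * s))) ∂(μ t) := by
    refine integral_mono_ae (sub_min_integrable hsub ht hu) ?_ ?_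
    · exact ((integrable_const 1).sub (sub_exp_integrable hsub ht hu')).const_mul 2
    · filter_upwards [sub_ae_nonneg hsub ht] with s hs
      have := min_le_two_exp (x := u⁻¹ * s) (by positivity)
      rwa [inv_mul_eq_div] at this ⊢
  refine h1.trans ?_
  rw [integral_const_mul, integral_sub (integrable_const 1) (sub_exp_integrable hsub ht hu'),
    hsub.laplace t _ ht hu']
  simp only [integral_const, probReal_univ, smul_eq_mul, mul_one]
  have := one_sub_exp_le_min (t * laplaceExp ν u⁻¹)
  have := this.trans (min_le_right _ _)
  linarith

lemma sub_tail_le {ν : Measure ℝ} {μ : ℝ → Measure ℝ} (hsub : IsSubordinatorLaw ν μ) {t u : ℝ} (ht : 0 < t) (hu : 0 < u) :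
    (μ t).real (Set.Ioi u) ≤ 2 * (t * laplaceExp ν u⁻¹) := by
  have := hsub.prob t ht
  refine le_trans ?_ (sub_min_le hsub ht hu)
  rw [← integral_indicator_one measurableSet_Ioi]
  refine integral_mono_ae ?_ (sub_min_integrable hsub ht hu) ?_
  · exact (integrable_indicator_iff measurableSet_Ioi).2
        (integrableOn_const (measure_ne_top _ _))
  · filter_upwards [sub_ae_nonneg hsub ht] with s hs
    by_cases hsR : u < s
    · rw [Set.indicator_of_mem (by exact hsR)]
      apply le_of_eq; symm
      apply min_eq_left
      rw [le_div_iff₀ hu]; linarith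
    · rw [Set.indicator_of_notMem (by simpa using hsR)]
      exact le_min zero_le_one (by positivity)


open MeasureTheory Real Set
open scoped ENNReal

lemma lap_diff_low {ν : Measure ℝ} (hν : IsLevyMeasure ν) {R₁ : ℝ≥0∞} {c c' β₁ β₂ : ℝ}
    (hc : 0 < c) (hc' : 0 < c') (hβ₁ : 0 < β₁) (hβ₂0 : 0 < β₂) (hβ₂ : β₂ < 1)
    (hp : PolyCond ν R₁ c c' β₁ β₂) :
    ∃ c1 : ℝ, 0 < c1 ∧ ∀ u : ℝ, 0 < u → ENNReal.ofReal u < R₁ →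
      c1 * laplaceExp ν u⁻¹ ≤ laplaceExp ν (2 * u⁻¹) - laplaceExp ν u⁻¹ := by
  obtain ⟨X, hX1, hX⟩ : ∃ X : ℝ, 1 < X ∧ 2 / c ≤ X ^ β₁ :=
    ((Filter.eventually_gt_atTop 1).and
      ((tendsto_rpow_atTop hβ₁).eventually_ge_atTop (2 / c))).exists
  have hX0 : 0 < X := by linarith
  set δ := X⁻¹ with hδ
  have hδ0 : 0 < δ := by positivity
  have hδ1 : δ < 1 := inv_lt_one_of_one_lt₀ hX1
  set κ := Real.exp (-1) * (1 - Real.exp (-δ)) with hκ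
  have hκ0 : 0 < κ := by
    apply mul_pos (Real.exp_pos _)
    have : Real.exp (-δ) < 1 := by rw [Real.exp_lt_one_iff]; linarith
    linarith
  set Cφ := c' / (1 - β₂) with hCφ
  have hCφ0 : 0 < Cφ := div_pos hc' (by linarith)
  refine ⟨κ / Cφ, by positivity, fun u hu huR => ?_⟩
  have hw0 := poly_pos hc hp hu huR
  have hl : 0 ≤ u⁻¹ := by positivity
  have hup := lap_le_tail hν hc hc' hβ₂0 hβ₂ hp hu huR
  have hδu : 0 < δ * u := by positivity
  have hδuu : δ * u ≤ u := by nlinarith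
  have hw : 2 * levyTail ν u ≤ levyTail ν (δ * u) := by
    have h1 := poly_low hc hp hδu hδuu huR
    have e : u / (δ * u) = X := by rw [hδ]; field_simp
    rw [e] at h1
    have : 2 ≤ c * X ^ β₁ := by rw [div_le_iff₀ hc] at hX; linarith
    nlinarith
  have hmeas : (ν (Set.Ioc (δ * u) u)).toReal = levyTail ν (δ * u) - levyTail ν u := by
    have : Set.Ioi (δ * u) = Set.Ioc (δ * u) u ∪ Set.Ioi u := (Set.Ioc_union_Ioi_eq_Ioi hδuu).symm
    unfold levyTail
    rw [this, measure_union (Set.Ioc_disjoint_Ioi le_rfl) measurableSet_Ioi,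
      ENNReal.toReal_add _ (hν.tail_fin u hu).ne]
    · ring
    · exact ((measure_mono Set.Ioc_subset_Ioi_self).trans_lt (hν.tail_fin _ hδu)).ne
  have hfin : ν (Set.Ioc (δ * u) u) ≠ ⊤ :=
    ((measure_mono Set.Ioc_subset_Ioi_self).trans_lt (hν.tail_fin _ hδu)).ne
  have hint : κ * (levyTail ν (δ * u) - levyTail ν u) ≤
      laplaceExp ν (2 * u⁻¹) - laplaceExp ν u⁻¹ := by
    unfold laplaceExp
    rw [← integral_sub (lap_integrable hν (by positivity)) (lap_integrable hν hl), ← hmeas]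
    have : κ * (ν (Set.Ioc (δ * u) u)).toReal =
        ∫ s, (Set.Ioc (δ * u) u).indicator (fun _ => κ) s ∂ν := by
      rw [integral_indicator_const _ measurableSet_Ioc, smul_eq_mul, mul_comm]; rfl
    rw [this]
    refine integral_mono_ae ?_
      ((lap_integrable hν (by positivity)).sub (lap_integrable hν hl)) ?_
    · exact (integrable_indicator_iff measurableSet_Ioc).2 (integrableOn_const hfin)
    · filter_upwards [levy_ae_pos hν] with s hs
      have e2 : Real.exp (-(2 * u⁻¹ * s)) = Real.exp (-(u⁻¹ * s)) * Real.exp (-(u⁻¹ * s)) := by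
        rw [← Real.exp_add]; congr 1; ring
      simp only [Pi.sub_apply, e2]
      have hz : 0 ≤ u⁻¹ * s := by positivity
      have hle1 : Real.exp (-(u⁻¹ * s)) ≤ 1 := by rw [Real.exp_le_one_iff]; linarith
      have hpos := Real.exp_pos (-(u⁻¹ * s))
      by_cases hs' : s ∈ Set.Ioc (δ * u) u
      · rw [Set.indicator_of_mem hs']
        have h1 : u⁻¹ * s ≤ 1 := by rw [inv_mul_eq_div, div_le_one hu]; exact hs'.2
        have h2 : δ ≤ u⁻¹ * s := by rw [inv_mul_eq_div, le_div_iff₀ hu]; exact hs'.1.le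
        have h3 : Real.exp (-1) ≤ Real.exp (-(u⁻¹ * s)) := Real.exp_le_exp.2 (by linarith)
        have h4 : Real.exp (-(u⁻¹ * s)) ≤ Real.exp (-δ) := Real.exp_le_exp.2 (by linarith)
        have : κ ≤ Real.exp (-(u⁻¹ * s)) * (1 - Real.exp (-(u⁻¹ * s))) := by
          apply mul_le_mul h3 (by linarith) _ hpos.le
          have : Real.exp (-δ) < 1 := by rw [Real.exp_lt_one_iff]; linarith
          linarith
        linarith
      · rw [Set.indicator_of_notMem hs']
        nlinarith
  have h5 : κ / Cφ * laplaceExp ν u⁻¹ ≤ κ / Cφ * (Cφ * levyTail ν u) := by gcongr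
  have h6 : κ / Cφ * (Cφ * levyTail ν u) = κ * levyTail ν u := by field_simp
  have h7 : κ * levyTail ν u ≤ κ * (levyTail ν (δ * u) - levyTail ν u) := by
    gcongr; linarith
  linarith

lemma sub_low {ν : Measure ℝ} {μ : ℝ → Measure ℝ} (hsub : IsSubordinatorLaw ν μ)
    {R₁ : ℝ≥0∞} {c c' β₁ β₂ : ℝ}
    (hc : 0 < c) (hc' : 0 < c') (hβ₁ : 0 < β₁) (hβ₂0 : 0 < β₂) (hβ₂ : β₂ < 1)
    (hp : PolyCond ν R₁ c c' β₁ β₂) :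
    ∃ ε K k : ℝ, 0 < ε ∧ ε < 1 ∧ 1 < K ∧ 0 < k ∧ ∀ t u : ℝ, 0 < t → 0 < u →
      ENNReal.ofReal u < R₁ → t * laplaceExp ν u⁻¹ ≤ 1 →
      k * (t * laplaceExp ν u⁻¹) ≤ (μ t).real (Set.Icc (ε * u) (K * u)) := by
  have hν := hsub.levy
  obtain ⟨c1, hc1, hdiff⟩ := lap_diff_low hν hc hc' hβ₁ hβ₂0 hβ₂ hp
  set Cφ := c' / (1 - β₂) with hCφ
  have hCφ0 : 0 < Cφ := div_pos hc' (by linarith)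
  set k0 := Real.exp (-2) * c1 with hk0
  have hk0p : 0 < k0 := by positivity
  obtain ⟨K, hK1, hK⟩ : ∃ K : ℝ, 1 < K ∧ Real.exp (-K) ≤ k0 / 8 :=
    ((Filter.eventually_gt_atTop 1).and
      (Real.tendsto_exp_neg_atTop_nhds_zero.eventually_le_const (by positivity))).exists
  obtain ⟨X, hX1, hX⟩ : ∃ X : ℝ, 1 < X ∧ X ^ (-(1 - β₂)) ≤ k0 / (16 * Cφ * c') :=
    ((Filter.eventually_gt_atTop 1).and
      ((tendsto_rpow_neg_atTop (by linarith : 0 < 1 - β₂)).eventually_le_const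
        (by positivity))).exists
  have hX0 : 0 < X := by linarith
  set ε := X⁻¹ with hε
  have hε0 : 0 < ε := by positivity
  have hε1 : ε < 1 := inv_lt_one_of_one_lt₀ hX1
  refine ⟨ε, K, k0 / 2, hε0, hε1, hK1, by positivity, fun t u ht hu huR hA => ?_⟩
  have := hsub.prob t ht
  have hl : 0 ≤ u⁻¹ := by positivity
  have hεu : 0 < ε * u := by positivity
  set A := t * laplaceExp ν u⁻¹ with hAdef
  have hA0 : 0 ≤ A := mul_nonneg ht.le (lap_nonneg hsub hl)
  -- lower
  have hlow : k0 * A ≤ ∫ s, (Real.exp (-(u⁻¹ * s)) - Real.exp (-(2 * u⁻¹ * s))) ∂(μ t) := by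
    rw [integral_sub (sub_exp_integrable hsub ht hl) (sub_exp_integrable hsub ht (by positivity)),
      hsub.laplace t _ ht hl, hsub.laplace t _ ht (by positivity)]
    set B := t * laplaceExp ν (2 * u⁻¹) with hB
    have hB2 : B ≤ 2 := by
      have := mul_le_mul_of_nonneg_left (lap_two hν hl) ht.le
      linarith
    have hBA : c1 * A ≤ B - A := by
      have := mul_le_mul_of_nonneg_left (hdiff u hu huR) ht.le
      rw [hB, hAdef]; linarith
    have e1 : Real.exp (-A) - Real.exp (-B) = Real.exp (-B) * (Real.exp (B - A) - 1) := by
      rw [mul_sub, ← Real.exp_add]; ring_nf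
    show k0 * A ≤ Real.exp (-A) - Real.exp (-B)
    rw [e1, hk0, mul_assoc]
    have h3 : Real.exp (-2) ≤ Real.exp (-B) := Real.exp_le_exp.2 (by linarith)
    have h4 := Real.add_one_le_exp (B - A)
    have h5 : 0 ≤ c1 * A := by positivity
    exact mul_le_mul h3 (by linarith) h5 (Real.exp_pos _).le
  -- upper
  have hI1 : Integrable ((Set.Icc (ε * u) (K * u)).indicator (1 : ℝ → ℝ)) (μ t) :=
    (integrable_indicator_iff measurableSet_Icc).2 (integrableOn_const (measure_ne_top _ _))
  have hI2 := (sub_min_integrable hsub ht hεu).const_mul ε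
  have hI3 := (sub_min_integrable hsub ht hu).const_mul (Real.exp (-K))
  have hup : ∫ s, (Real.exp (-(u⁻¹ * s)) - Real.exp (-(2 * u⁻¹ * s))) ∂(μ t) ≤
      ∫ s, ((Set.Icc (ε * u) (K * u)).indicator (1 : ℝ → ℝ) s + (ε * min 1 (s / (ε * u)) +
        Real.exp (-K) * min 1 (s / u))) ∂(μ t) := by
    refine integral_mono_ae ((sub_exp_integrable hsub ht hl).sub
      (sub_exp_integrable hsub ht (by positivity))) (hI1.add (hI2.add hI3)) ?_
    filter_upwards [sub_ae_nonneg hsub ht] with s hs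
    have e2 : Real.exp (-(2 * u⁻¹ * s)) = Real.exp (-(u⁻¹ * s)) * Real.exp (-(u⁻¹ * s)) := by
      rw [← Real.exp_add]; congr 1; ring
    simp only [e2]
    have hz : 0 ≤ u⁻¹ * s := by positivity
    have hle1 : Real.exp (-(u⁻¹ * s)) ≤ 1 := by rw [Real.exp_le_one_iff]; linarith
    have hpos := Real.exp_pos (-(u⁻¹ * s))
    have hm1 : 0 ≤ ε * min 1 (s / (ε * u)) := by
      apply mul_nonneg hε0.le (le_min zero_le_one (by positivity))
    have hm2 : 0 ≤ Real.exp (-K) * min 1 (s / u) := by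
      apply mul_nonneg (Real.exp_pos _).le (le_min zero_le_one (by positivity))
    by_cases hin : s ∈ Set.Icc (ε * u) (K * u)
    · rw [Set.indicator_of_mem hin]
      simp only [Pi.one_apply]
      nlinarith
    · rw [Set.indicator_of_notMem hin]
      rw [Set.mem_Icc, not_and_or, not_le, not_le] at hin
      rcases hin with hin | hin
      · have : min 1 (s / (ε * u)) = s / (ε * u) := by
          apply min_eq_right; rw [div_le_one hεu]; exact hin.le
        rw [this] at hm1 ⊢
        have e3 : ε * (s / (ε * u)) = u⁻¹ * s := by field_simp
        rw [e3]
        have h4 := Real.add_one_le_exp (-(u⁻¹ * s))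
        nlinarith
      · have : min 1 (s / u) = 1 := by
          apply min_eq_left; rw [le_div_iff₀ hu]; nlinarith
        rw [this] at hm2 ⊢
        have : Real.exp (-(u⁻¹ * s)) ≤ Real.exp (-K) := by
          apply Real.exp_le_exp.2
          have : K ≤ u⁻¹ * s := by rw [inv_mul_eq_div, le_div_iff₀ hu]; exact hin.le
          linarith
        nlinarith
  have hI23 : Integrable (fun s => ε * min 1 (s / (ε * u)) + Real.exp (-K) * min 1 (s / u)) (μ t) :=
    hI2.add hI3
  rw [integral_add hI1 hI23, integral_add hI2 hI3, integral_const_mul, integral_const_mul,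
    integral_indicator_one measurableSet_Icc] at hup
  have hb1 := sub_min_le hsub ht hεu
  have hb2 := sub_min_le hsub ht hu
  have hsc : laplaceExp ν (ε * u)⁻¹ ≤ 2 * Cφ * c' * X ^ β₂ * laplaceExp ν u⁻¹ := by
    have huu : ε * u ≤ u := by nlinarith
    have hεR : ENNReal.ofReal (ε * u) < R₁ :=
      (ENNReal.ofReal_le_ofReal huu).trans_lt huR
    have h1 := lap_le_tail hν hc hc' hβ₂0 hβ₂ hp hεu hεR
    have h2 := poly_up hc hp hεu huu huR
    have e : u / (ε * u) = X := by rw [hε]; field_simp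
    rw [e] at h2
    have h3 := lap_ge_tail hν hu
    have hXp : 0 < X ^ β₂ := by positivity
    calc laplaceExp ν (ε * u)⁻¹ ≤ Cφ * levyTail ν (ε * u) := h1
      _ ≤ Cφ * (c' * X ^ β₂ * (2 * laplaceExp ν u⁻¹)) := by
          gcongr
          refine h2.trans ?_
          gcongr
      _ = _ := by ring
  have hXX : ε * X ^ β₂ = X ^ (-(1 - β₂)) := by
    rw [hε, ← Real.rpow_neg_one, ← Real.rpow_add hX0]; congr 1; ring
  have hterm : ε * ∫ s, min 1 (s / (ε * u)) ∂(μ t) ≤ k0 / 4 * A := by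
    calc ε * ∫ s, min 1 (s / (ε * u)) ∂(μ t) ≤ ε * (2 * (t * laplaceExp ν (ε * u)⁻¹)) := by gcongr
      _ ≤ ε * (2 * (t * (2 * Cφ * c' * X ^ β₂ * laplaceExp ν u⁻¹))) := by gcongr
      _ = 4 * Cφ * c' * (ε * X ^ β₂) * A := by rw [hAdef]; ring
      _ ≤ 4 * Cφ * c' * (k0 / (16 * Cφ * c')) * A := by rw [hXX]; gcongr
      _ = k0 / 4 * A := by field_simp; ring
  have hterm2 : Real.exp (-K) * ∫ s, min 1 (s / u) ∂(μ t) ≤ k0 / 4 * A := by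
    calc Real.exp (-K) * ∫ s, min 1 (s / u) ∂(μ t) ≤ Real.exp (-K) * (2 * A) := by gcongr
      _ ≤ k0 / 8 * (2 * A) := by gcongr
      _ = k0 / 4 * A := by ring
  linarith

lemma exp_neg_le_pow (N : ℕ) {z : ℝ} (hz : 0 < z) :
    Real.exp (-z) ≤ (N.factorial : ℝ) / z ^ N := by
  have h := Real.pow_div_factorial_le_exp z hz.le N
  rw [Real.exp_neg, le_div_iff₀ (by positivity), inv_mul_le_iff₀ (Real.exp_pos _)]
  rwa [div_le_iff₀ (by positivity)] at h

lemma sub_neg_moment {ν : Measure ℝ} {μ : ℝ → Measure ℝ} (hsub : IsSubordinatorLaw ν μ)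
    {φInv : ℝ → ℝ} (hφ : IsPhiInv ν φInv)
    {R₁ : ℝ≥0∞} {c c' β₁ β₂ : ℝ}
    (hc : 0 < c) (hc' : 0 < c') (hβ₁ : 0 < β₁) (hβ₂0 : 0 < β₂) (hβ₂ : β₂ < 1)
    (hp : PolyCond ν R₁ c c' β₁ β₂) {γ : ℝ} (hγ : 0 ≤ γ) :
    ∃ C : ℝ, 0 < C ∧ ∀ t a : ℝ, 0 < t → 0 < a →
      ENNReal.ofReal a < R₁ → t * laplaceExp ν a⁻¹ = 1 →
      ∫⁻ s, ENNReal.ofReal ((a / s) ^ γ) ∂(μ t) ≤ ENNReal.ofReal C := by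
  have hν := hsub.levy
  set Cφ := c' / (1 - β₂) with hCφ
  have hCφ0 : 0 < Cφ := div_pos hc' (by linarith)
  set κ := c / (2 * Cφ) with hκ
  have hκ0 : 0 < κ := by positivity
  obtain ⟨N, hN⟩ := exists_nat_ge ((γ + 1) / β₁)
  rw [div_le_iff₀ hβ₁] at hN
  set M := Real.exp 1 * 2 ^ γ * ((N.factorial : ℝ) / κ ^ N) with hM
  have hM0 : 0 < M := by positivity
  refine ⟨1 + M * 2, by positivity, fun t a ht ha haR hta => ?_⟩
  have := hsub.prob t ht
  have hpt : ∀ᵐ s ∂(μ t), ENNReal.ofReal ((a / s) ^ γ) ≤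
      1 + ∑' n : ℕ, ENNReal.ofReal (Real.exp 1 * 2 ^ γ * ((2:ℝ) ^ n) ^ γ *
        Real.exp (-((2:ℝ) ^ n * a⁻¹ * s))) := by
    filter_upwards [sub_ae_pos hsub hφ ht] with s hs
    rcases le_total (a / s) 1 with h1 | h1
    · refine le_trans ?_ le_self_add
      rw [← ENNReal.ofReal_one]
      exact ENNReal.ofReal_le_ofReal (Real.rpow_le_one (by positivity) h1 hγ)
    · obtain ⟨n, hn1, hn2⟩ := exists_nat_pow_near h1 (by norm_num : (1:ℝ) < 2)
      refine le_trans ?_ le_add_self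
      refine le_trans ?_ (ENNReal.le_tsum n)
      apply ENNReal.ofReal_le_ofReal
      have h3 : (a / s) ^ γ ≤ 2 ^ γ * ((2:ℝ) ^ n) ^ γ := by
        rw [← Real.mul_rpow (by norm_num) (by positivity)]
        apply Real.rpow_le_rpow (by positivity) _ hγ
        rw [pow_succ] at hn2; linarith
      have h4 : 1 ≤ Real.exp 1 * Real.exp (-((2:ℝ) ^ n * a⁻¹ * s)) := by
        rw [← Real.exp_add]
        apply Real.one_le_exp
        have : (2:ℝ) ^ n * a⁻¹ * s ≤ 1 := by
          rw [le_div_iff₀ hs] at hn1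
          rw [mul_right_comm, ← div_eq_mul_inv, div_le_one ha]
          exact hn1
        linarith
      have h5 : 0 ≤ (2:ℝ) ^ γ * ((2:ℝ) ^ n) ^ γ := by positivity
      nlinarith
  refine (lintegral_mono_ae hpt).trans ?_
  rw [lintegral_add_left measurable_const, lintegral_const, measure_univ, mul_one,
    lintegral_tsum (fun n => by fun_prop)]
  have hterm : ∀ n : ℕ, ∫⁻ s, ENNReal.ofReal (Real.exp 1 * 2 ^ γ * ((2:ℝ) ^ n) ^ γ *
        Real.exp (-((2:ℝ) ^ n * a⁻¹ * s))) ∂(μ t) ≤ ENNReal.ofReal (M * (1 / 2) ^ n) := by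
    intro n
    have hpos2 : (0:ℝ) < 2 ^ n := by positivity
    rw [← ofReal_integral_eq_lintegral_ofReal
      ((sub_exp_integrable hsub ht (by positivity)).const_mul _)
      (Filter.Eventually.of_forall fun s => by positivity)]
    apply ENNReal.ofReal_le_ofReal
    rw [integral_const_mul, hsub.laplace t _ ht (by positivity)]
    have hsmall : (2:ℝ) ^ n * a⁻¹ = (a / 2 ^ n)⁻¹ := by field_simp
    have hau : a / 2 ^ n ≤ a := div_le_self ha.le (one_le_pow₀ (by norm_num))
    have hau0 : 0 < a / 2 ^ n := by positivity
    have h1 := lap_ge_tail hν hau0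
    have h2 := poly_low hc hp hau0 hau haR
    have h3 := lap_le_tail hν hc hc' hβ₂0 hβ₂ hp ha haR
    have e : a / (a / 2 ^ n) = 2 ^ n := by field_simp
    rw [e] at h2
    have hQ : (0:ℝ) < ((2:ℝ) ^ n) ^ β₁ := by positivity
    have h4 : κ * ((2:ℝ) ^ n) ^ β₁ ≤ t * laplaceExp ν (2 ^ n * a⁻¹) := by
      rw [hsmall]
      have h5 : c * ((2:ℝ) ^ n) ^ β₁ / Cφ * laplaceExp ν a⁻¹ ≤
          2 * laplaceExp ν (a / 2 ^ n)⁻¹ := by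
        calc c * ((2:ℝ) ^ n) ^ β₁ / Cφ * laplaceExp ν a⁻¹
            ≤ c * ((2:ℝ) ^ n) ^ β₁ / Cφ * (Cφ * levyTail ν a) := by gcongr
          _ = c * ((2:ℝ) ^ n) ^ β₁ * levyTail ν a := by field_simp
          _ ≤ _ := h2.trans h1
      have h6 := mul_le_mul_of_nonneg_left h5 ht.le
      have e6 : t * (c * ((2:ℝ) ^ n) ^ β₁ / Cφ * laplaceExp ν a⁻¹) =
        2 * (κ * ((2:ℝ) ^ n) ^ β₁) := by
        calc _ = c * ((2:ℝ) ^ n) ^ β₁ / Cφ * (t * laplaceExp ν a⁻¹) := by ring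
          _ = _ := by rw [hta, hκ]; field_simp
      rw [e6] at h6
      linarith
    have h7 : Real.exp (-(t * laplaceExp ν (2 ^ n * a⁻¹))) ≤
        (N.factorial : ℝ) / (κ * ((2:ℝ) ^ n) ^ β₁) ^ N :=
      (Real.exp_le_exp.2 (neg_le_neg h4)).trans (exp_neg_le_pow N (by positivity))
    have h8 : ((2:ℝ) ^ n) ^ γ / (((2:ℝ) ^ n) ^ β₁) ^ N ≤ (1 / 2) ^ n := by
      rw [← Real.rpow_natCast (((2:ℝ) ^ n) ^ β₁) N, ← Real.rpow_mul hpos2.le,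
        ← Real.rpow_sub hpos2, one_div, inv_pow, ← Real.rpow_neg_one (2 ^ n)]
      apply Real.rpow_le_rpow_of_exponent_le (one_le_pow₀ (by norm_num))
      rw [mul_comm]; linarith
    calc Real.exp 1 * 2 ^ γ * ((2:ℝ) ^ n) ^ γ * Real.exp (-(t * laplaceExp ν (2 ^ n * a⁻¹)))
        ≤ Real.exp 1 * 2 ^ γ * ((2:ℝ) ^ n) ^ γ *
          ((N.factorial : ℝ) / (κ * ((2:ℝ) ^ n) ^ β₁) ^ N) := by gcongr
      _ = M * (((2:ℝ) ^ n) ^ γ / (((2:ℝ) ^ n) ^ β₁) ^ N) := by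
          rw [hM, mul_pow]; field_simp
      _ ≤ _ := by gcongr
  have hsum : ∑' n : ℕ, ENNReal.ofReal (M * (1 / 2) ^ n) = ENNReal.ofReal (M * 2) := by
    rw [← ENNReal.ofReal_tsum_of_nonneg (fun n => by positivity)
      (summable_geometric_two.mul_left M), tsum_mul_left, tsum_geometric_two]
  rw [ENNReal.ofReal_add zero_le_one (by positivity), ENNReal.ofReal_one, ← hsum]
  gcongr with n
  exact hterm n

open MeasureTheory Real Set
open scoped ENNReal


lemma vol_pos {E : Type*} [MetricSpace E] [MeasurableSpace E] {m : Measure E}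
    (hm : ∀ (x : E) (r : ℝ), 0 < r → 0 < m (Metric.ball x r) ∧ m (Metric.ball x r) < ⊤)
    (x : E) {r : ℝ} (hr : 0 < r) : 0 < vol m x r :=
  ENNReal.toReal_pos (hm x r hr).1.ne' (hm x r hr).2.ne

lemma vol_mono' {E : Type*} [MetricSpace E] [MeasurableSpace E] {m : Measure E}
    (hm : ∀ (x : E) (r : ℝ), 0 < r → 0 < m (Metric.ball x r) ∧ m (Metric.ball x r) < ⊤)
    (x z : E) {r R : ℝ} (hR : 0 < R) (h : Metric.ball x r ⊆ Metric.ball z R) :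
    vol m x r ≤ vol m z R :=
  ENNReal.toReal_mono (hm z R hR).2.ne (measure_mono h)

lemma vol_mono {E : Type*} [MetricSpace E] [MeasurableSpace E] {m : Measure E}
    (hm : ∀ (x : E) (r : ℝ), 0 < r → 0 < m (Metric.ball x r) ∧ m (Metric.ball x r) < ⊤)
    (x : E) {r R : ℝ} (hR : 0 < R) (h : r ≤ R) : vol m x r ≤ vol m x R :=
  vol_mono' hm x x hR (Metric.ball_subset_ball h)

lemma vol_doub {E : Type*} [MetricSpace E] [MeasurableSpace E] {m : Measure E}
    (hm : ∀ (x : E) (r : ℝ), 0 < r → 0 < m (Metric.ball x r) ∧ m (Metric.ball x r) < ⊤)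
    {R_E : ℝ≥0∞} {d₁ d₂ : ℝ} (hRE : 0 < R_E) (hVD : VolDoubling m R_E d₁ d₂)
    (Rm : ℝ) : ∃ CV : ℝ, 1 ≤ CV ∧ ∀ (x : E) (r R : ℝ), 0 < r → r ≤ R → R ≤ Rm →
      vol m x R ≤ CV * (R / r) ^ d₂ * vol m x r := by
  obtain ⟨a, ha1, ha⟩ : ∃ a : ℝ, 1 ≤ a ∧ ENNReal.ofReal Rm < ENNReal.ofReal a * R_E := by
    by_cases htop : R_E = ⊤
    · refine ⟨1, le_rfl, ?_⟩
      rw [htop, ENNReal.ofReal_one, one_mul]; exact ENNReal.ofReal_lt_top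
    · have h0 : 0 < R_E.toReal := ENNReal.toReal_pos hRE.ne' htop
      refine ⟨max 1 ((|Rm| + 1) / R_E.toReal), le_max_left _ _, ?_⟩
      have h1 : Rm < max 1 ((|Rm| + 1) / R_E.toReal) * R_E.toReal := by
        calc Rm < |Rm| + 1 := by linarith [le_abs_self Rm]
          _ = ((|Rm| + 1) / R_E.toReal) * R_E.toReal := by field_simp
          _ ≤ _ := by gcongr; exact le_max_right _ _
      have h2 := (ENNReal.ofReal_lt_ofReal_iff (by positivity)).2 h1
      rwa [ENNReal.ofReal_mul (by positivity), ENNReal.ofReal_toReal htop] at h2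
  obtain ⟨CV, hCV, H⟩ := hVD a ha1
  refine ⟨CV, hCV, fun x r R hr hrR hRm => ?_⟩
  have := (H x r R hr hrR ((ENNReal.ofReal_le_ofReal hRm).trans_lt ha)).2
  rwa [div_le_iff₀ (vol_pos hm x hr)] at this

lemma vol_max {E : Type*} [MetricSpace E] [MeasurableSpace E] {m : Measure E}
    (hm : ∀ (x : E) (r : ℝ), 0 < r → 0 < m (Metric.ball x r) ∧ m (Metric.ball x r) < ⊤)
    {D : Set E} (hD : Bornology.IsBounded D) (hne : D.Nonempty) :
    ∃ Vm : ℝ, 0 < Vm ∧ ∀ x ∈ D, ∀ r ≤ Metric.diam D, vol m x r ≤ Vm := by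
  obtain ⟨x0, hx0⟩ := hne
  have hd0 : 0 ≤ Metric.diam D := Metric.diam_nonneg
  refine ⟨vol m x0 (2 * Metric.diam D + 1), vol_pos hm _ (by positivity), fun x hx r hr => ?_⟩
  apply vol_mono' hm _ _ (by positivity)
  intro z hz
  rw [Metric.mem_ball] at hz ⊢
  have h1 := Metric.dist_le_diam_of_mem hD hx hx0
  have h2 := dist_triangle z x x0
  linarith

lemma vol_min {E : Type*} [MetricSpace E] [MeasurableSpace E] {m : Measure E}
    (hm : ∀ (x : E) (r : ℝ), 0 < r → 0 < m (Metric.ball x r) ∧ m (Metric.ball x r) < ⊤)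
    {R_E : ℝ≥0∞} {d₁ d₂ : ℝ} (hRE : 0 < R_E) (hVD : VolDoubling m R_E d₁ d₂)
    {D : Set E} (hD : Bornology.IsBounded D) (hne : D.Nonempty) {r0 : ℝ} (hr0 : 0 < r0) :
    ∃ Vm : ℝ, 0 < Vm ∧ ∀ x ∈ D, ∀ r, r0 ≤ r → Vm ≤ vol m x r := by
  obtain ⟨x0, hx0⟩ := hne
  have hd0 : 0 ≤ Metric.diam D := Metric.diam_nonneg
  set R := r0 + Metric.diam D with hR
  have hR0 : 0 < R := by positivity
  obtain ⟨CV, hCV, H⟩ := vol_doub hm hRE hVD R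
  have hK : 0 < CV * (R / r0) ^ d₂ := by positivity
  have hV0 := vol_pos hm x0 hr0
  refine ⟨vol m x0 r0 / (CV * (R / r0) ^ d₂), by positivity, fun x hx r hr => ?_⟩
  rw [div_le_iff₀ hK]
  have h1 : vol m x0 r0 ≤ vol m x R := by
    apply vol_mono' hm _ _ hR0
    intro z hz
    rw [Metric.mem_ball] at hz ⊢
    have h1 := Metric.dist_le_diam_of_mem hD hx hx0
    have h2 := dist_triangle z x0 x
    rw [dist_comm] at h1
    linarith
  have h2 := H x r0 R hr0 (by linarith) le_rfl
  have h3 := vol_mono hm x (hr0.trans_le hr) hr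
  calc vol m x0 r0 ≤ CV * (R / r0) ^ d₂ * vol m x r0 := h1.trans h2
    _ ≤ CV * (R / r0) ^ d₂ * vol m x r := by gcongr
    _ = _ := by ring


lemma phi_pos {Φ : ℝ → ℝ} (hΦ0 : Φ 0 = 0) (hΦmono : StrictMonoOn Φ (Set.Ici 0)) {r : ℝ}
    (hr : 0 < r) : 0 < Φ r := by
  have := hΦmono (Set.mem_Ici.2 le_rfl) (Set.mem_Ici.2 hr.le) hr
  rwa [hΦ0] at this

lemma psi_le_phi {Φ Ψ : ℝ → ℝ} (hΦ0 : Φ 0 = 0) (hΦmono : StrictMonoOn Φ (Set.Ici 0))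
    (hΨmono : StrictMonoOn Ψ (Set.Ici 0)) {R₁ : ℝ≥0∞} (hR₁ : 0 < R₁)
    (hcomp : ∃ k : ℝ, 0 < k ∧ ∀ r : ℝ, 0 < r → ENNReal.ofReal r < R₁ → Ψ r ≤ k * Φ r) (d : ℝ) :
    ∃ k : ℝ, 0 < k ∧ ∀ r : ℝ, 0 < r → r ≤ d → Ψ r ≤ k * Φ r := by
  obtain ⟨k, hk, H⟩ := hcomp
  by_cases htop : R₁ = ⊤
  · exact ⟨k, hk, fun r hr _ => H r hr (by rw [htop]; exact ENNReal.ofReal_lt_top)⟩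
  have hR0 : 0 < R₁.toReal := ENNReal.toReal_pos hR₁.ne' htop
  have hF0 := phi_pos hΦ0 hΦmono hR0
  refine ⟨max k (Ψ d / Φ R₁.toReal), lt_max_of_lt_left hk, fun r hr hrd => ?_⟩
  have hFr := phi_pos hΦ0 hΦmono hr
  by_cases hrR : ENNReal.ofReal r < R₁
  · refine (H r hr hrR).trans ?_
    gcongr
    exact le_max_left _ _
  · rw [not_lt] at hrR
    have h1 : R₁.toReal ≤ r := ENNReal.toReal_le_of_le_ofReal hr.le hrR
    have h2 : Φ R₁.toReal ≤ Φ r := hΦmono.monotoneOn hR0.le hr.le h1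
    have h3 : Ψ r ≤ Ψ d := hΨmono.monotoneOn hr.le (hr.le.trans hrd) hrd
    rcases le_or_gt (Ψ d) 0 with h4 | h4
    · have : 0 < max k (Ψ d / Φ R₁.toReal) := lt_max_of_lt_left hk
      have : 0 < max k (Ψ d / Φ R₁.toReal) * Φ r := by positivity
      linarith
    calc Ψ r ≤ Ψ d := h3
      _ = Ψ d / Φ R₁.toReal * Φ R₁.toReal := by field_simp
      _ ≤ Ψ d / Φ R₁.toReal * Φ r := by gcongr
      _ ≤ _ := by gcongr; exact le_max_right _ _

open MeasureTheory Real Set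
open scoped ENNReal

set_option maxHeartbeats 4000000 in
lemma pD_up
    {E : Type*} [MetricSpace E] [MeasurableSpace E]
    (m : Measure E) (R_E : ℝ≥0∞) (d₁ d₂ : ℝ)
    (hm : ∀ (x : E) (r : ℝ), 0 < r → 0 < m (Metric.ball x r) ∧ m (Metric.ball x r) < ⊤)
    (hRE : 0 < R_E) (hVD : VolDoubling m R_E d₁ d₂)
    (D : Set E) (hDne : D.Nonempty)
    (Φ Ψ : ℝ → ℝ) (cA cA' α₁ α₂ : ℝ)
    (hΦ0 : Φ 0 = 0) (hΦmono : StrictMonoOn Φ (Set.Ici 0))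
    (hΦΨ : ∀ r : ℝ, 0 ≤ r → Φ r ≤ Ψ r)
    (hcA' : 0 < cA')
    (hΦsc : WeakScaling Φ cA cA' α₁ α₂)
    (ΦInv : ℝ → ℝ) (hΦInv : ∀ s : ℝ, 0 < s → 0 < ΦInv s ∧ Φ (ΦInv s) = s)
    (h : ℝ → E → E → ℝ) (cH γ : ℝ) (hcH : 0 < cH) (hγ : 0 ≤ γ)
    (pD : ℝ → E → E → ℝ)
    (C₀ cl cexl cu cexu : ℝ) (hC₀ : 0 ≤ C₀)
    (hcu : 0 < cu) (hcexu : 0 < cexu)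
    (hDbdd : Bornology.IsBounded D)
    (hbf : IsBoundaryFunction D h (ENNReal.ofReal (4 * Φ (Metric.diam D) + 1)) cH γ)
    (hHK : HKest m D Ψ ΦInv h pD C₀ cl cexl cu cexu (fun t => t ≤ 1))
    (lamD c₅ c₆ : ℝ) (hlamD : 0 < lamD) (hc₆ : 0 < c₆)
    (hHKlarge : HKlarge D h pD lamD c₅ c₆) :
    ∃ C : ℝ, 0 < C ∧ ∀ x y : E, x ∈ D → y ∈ D → 0 < dist x y → ∀ s : ℝ, 0 < s →
      (s ≤ Φ (dist x y) → pD s x y ≤ C / vol m x (dist x y) *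
        (h s x y * (C₀ * (s / Φ (dist x y)) + (s / Φ (dist x y)) ^ (γ + 1)))) ∧
      (Φ (dist x y) < s → pD s x y ≤ C / vol m x (dist x y) * h (Φ (dist x y)) x y) := by
  obtain ⟨hb01, hb1, hb2⟩ := hbf
  set d := Metric.diam D with hd
  obtain ⟨CV, hCV, HV⟩ := vol_doub hm hRE hVD d
  obtain ⟨Vm, hVm, HVm⟩ := vol_max hm hDbdd hDne
  obtain ⟨N, hN⟩ := exists_nat_ge ((d₂ + α₂ * (γ + 1)) / 2)
  set Fm := max 1 (Φ d) with hFm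
  have hFm1 : 1 ≤ Fm := le_max_left _ _
  have hFm0 : 0 < Fm := by linarith
  set K1 := CV * (N.factorial / cexu ^ N) * cA' ^ (γ + 1) with hK1
  have hK10 : 0 < K1 := by positivity
  set K2 := c₆ * (cH * Fm ^ γ) * Vm * Fm ^ (γ + 1) with hK2
  have hK20 : 0 < K2 := by positivity
  set K3 := c₆ * (1 + cH * Fm ^ γ) * Vm with hK3
  have hK30 : 0 < K3 := by positivity
  refine ⟨cu * (1 + K1) + K2 + K3, by positivity, fun x y hx hy hr s hs => ?_⟩
  set C := cu * (1 + K1) + K2 + K3 with hC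
  set r := dist x y with hrdef
  have hrd : r ≤ d := Metric.dist_le_diam_of_mem hDbdd hx hy
  have hd0 : 0 < d := hr.trans_le hrd
  set F := Φ r with hF
  have hF0 : 0 < F := phi_pos hΦ0 hΦmono hr
  have hFFm : F ≤ Φ d := hΦmono.monotoneOn hr.le hd0.le hrd
  have hFd0 : 0 < Φ d := phi_pos hΦ0 hΦmono hd0
  have hFFm' : F ≤ Fm := hFFm.trans (le_max_right _ _)
  set V := vol m x r with hV
  have hV0 : 0 < V := vol_pos hm x hr
  have hVVm : V ≤ Vm := HVm x hx r hrd
  have hhor : ∀ u : ℝ, u ≤ Φ d → ENNReal.ofReal u < ENNReal.ofReal (4 * Φ d + 1) := by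
    intro u hu
    apply (ENNReal.ofReal_lt_ofReal_iff (by positivity)).2
    linarith
  have hh0 : ∀ u : ℝ, 0 < u → 0 ≤ h u x y := fun u hu => (hb01 u x y hu hx hy).1
  have h1V : 1 ≤ Vm / V := by rwa [one_le_div hV0]
  have hlarge : 1 ≤ s → pD s x y ≤ c₆ * h 1 x y := by
    intro hs1
    refine (hHKlarge s x y hs1 hx hy).2.trans ?_
    have h1 : Real.exp (-(lamD * s)) ≤ 1 := by
      rw [Real.exp_le_one_iff]; have := mul_pos hlamD hs; linarith
    have h2 := hh0 1 one_pos
    have h3 : Real.exp (-(lamD * s)) * h 1 x y ≤ 1 * h 1 x y := by gcongr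
    nlinarith
  obtain ⟨hρ0, hρs⟩ := hΦInv s hs
  set ρ := ΦInv s with hρ
  constructor
  · intro hsF
    have hsF0 : 0 < s / F := by positivity
    have hP0 : 0 < (s / F) ^ (γ + 1) := by positivity
    rcases le_total s 1 with hs1 | hs1
    · have hp := (hHK s x y hs hs1 hx hy).2
      have hρr : ρ ≤ r := by
        by_contra hcon
        rw [not_le] at hcon
        have := hΦmono (Set.mem_Ici.2 hr.le) (Set.mem_Ici.2 hρ0.le) hcon
        rw [hρs] at this; linarith
      have hvρ := vol_pos hm x hρ0
      set Y := r / ρ with hY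
      have hY1 : 1 ≤ Y := by rwa [one_le_div hρ0]
      have hY0 : 0 < Y := by linarith
      have hA : (vol m x ρ)⁻¹ ≤ CV * Y ^ d₂ / V := by
        rw [inv_le_iff_one_le_mul₀ hvρ, ← mul_div_right_comm, one_le_div hV0]
        exact HV x ρ r hρ0 hρr hrd
      have hexp : Real.exp (-(cexu * r ^ 2 / ρ ^ 2)) ≤
          (N.factorial : ℝ) / cexu ^ N * Y ^ (-(2 * N : ℝ)) := by
        have h1 := exp_neg_le_pow N (z := cexu * Y ^ 2) (by positivity)
        have e : cexu * r ^ 2 / ρ ^ 2 = cexu * Y ^ 2 := by rw [hY, div_pow]; ring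
        rw [e]
        refine h1.trans (le_of_eq ?_)
        rw [Real.rpow_neg hY0.le, mul_pow, ← pow_mul]
        have : Y ^ (2 * N : ℝ) = Y ^ (2 * N) := by
          rw [← Real.rpow_natCast]; push_cast; rfl
        rw [this]; field_simp
      have hsc : (s / F)⁻¹ ≤ cA' * Y ^ α₂ := by
        have := (hΦsc ρ r hρ0 hρr).2
        rw [hρs] at this
        rw [inv_div]; exact this
      have hPY : Y ^ (-(α₂ * (γ + 1))) ≤ cA' ^ (γ + 1) * (s / F) ^ (γ + 1) := by
        have h1 : ((s / F)⁻¹) ^ (γ + 1) ≤ (cA' * Y ^ α₂) ^ (γ + 1) :=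
          Real.rpow_le_rpow (by positivity) hsc (by linarith)
        rw [Real.inv_rpow hsF0.le, Real.mul_rpow hcA'.le (by positivity), ← Real.rpow_mul hY0.le,
          inv_le_iff_one_le_mul₀ hP0] at h1
        rw [Real.rpow_neg hY0.le, inv_le_iff_one_le_mul₀ (by positivity)]
        linarith
      have hprod : (vol m x ρ)⁻¹ * Real.exp (-(cexu * r ^ 2 / ρ ^ 2)) ≤
          K1 / V * (s / F) ^ (γ + 1) := by
        have hYY : Y ^ d₂ * Y ^ (-(2 * N : ℝ)) ≤ Y ^ (-(α₂ * (γ + 1))) := by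
          rw [← Real.rpow_add hY0]
          apply Real.rpow_le_rpow_of_exponent_le hY1
          rw [div_le_iff₀ (by norm_num)] at hN
          linarith
        calc (vol m x ρ)⁻¹ * Real.exp (-(cexu * r ^ 2 / ρ ^ 2))
            ≤ (CV * Y ^ d₂ / V) * ((N.factorial : ℝ) / cexu ^ N * Y ^ (-(2 * N : ℝ))) := by
              gcongr
          _ = CV * ((N.factorial : ℝ) / cexu ^ N) / V * (Y ^ d₂ * Y ^ (-(2 * N : ℝ))) := by ring
          _ ≤ CV * ((N.factorial : ℝ) / cexu ^ N) / V * (cA' ^ (γ + 1) * (s / F) ^ (γ + 1)) := by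
              exact mul_le_mul_of_nonneg_left (hYY.trans hPY) (by positivity)
          _ = _ := by rw [hK1]; ring
      have hfirst : C₀ * s / (V * Ψ r) ≤ 1 / V * (C₀ * (s / F)) := by
        have : 1 / V * (C₀ * (s / F)) = C₀ * s / (V * F) := by field_simp
        rw [this]
        gcongr
        exact hΦΨ r hr.le
      have hmin := (min_le_right ((vol m x ρ)⁻¹) (C₀ * s / (V * Ψ r) +
          (vol m x ρ)⁻¹ * Real.exp (-(cexu * r ^ 2 / ρ ^ 2)))).trans (add_le_add hfirst hprod)
      have hcoef : 0 ≤ cu * h s x y := mul_nonneg hcu.le (hh0 s hs)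
      refine hp.trans ((mul_le_mul_of_nonneg_left hmin hcoef).trans ?_)
      have hq : 0 ≤ C₀ * (s / F) := by positivity
      have hq2 : 1 / V * (C₀ * (s / F)) + K1 / V * (s / F) ^ (γ + 1) ≤
          (1 + K1) / V * (C₀ * (s / F) + (s / F) ^ (γ + 1)) := by
        have e : (1 + K1) / V * (C₀ * (s / F) + (s / F) ^ (γ + 1)) =
          (1 / V * (C₀ * (s / F)) + K1 / V * (s / F) ^ (γ + 1)) +
            (K1 / V * (C₀ * (s / F)) + 1 / V * (s / F) ^ (γ + 1)) := by ring
        rw [e]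
        have : 0 ≤ K1 / V * (C₀ * (s / F)) + 1 / V * (s / F) ^ (γ + 1) := by positivity
        linarith
      have hh := hh0 s hs
      calc cu * h s x y * (1 / V * (C₀ * (s / F)) + K1 / V * (s / F) ^ (γ + 1))
          ≤ cu * h s x y * ((1 + K1) / V * (C₀ * (s / F) + (s / F) ^ (γ + 1))) := by gcongr
        _ = (cu * (1 + K1)) / V * (h s x y * (C₀ * (s / F) + (s / F) ^ (γ + 1))) := by ring
        _ ≤ _ := by
            gcongr
            linarith
    · have h1 := hb2 x y hx hy 1 s one_pos hs1 (hhor s (hsF.trans hFFm))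
      rw [Real.one_rpow, one_mul] at h1
      have hsFm : s ^ γ ≤ Fm ^ γ := Real.rpow_le_rpow hs.le (hsF.trans hFFm') hγ
      have hh := hh0 s hs
      have h2 : h 1 x y ≤ cH * Fm ^ γ * h s x y := by
        refine h1.trans ?_
        rw [mul_assoc]
        gcongr
      have h3 : 1 ≤ Fm ^ (γ + 1) * (s / F) ^ (γ + 1) := by
        rw [← Real.mul_rpow hFm0.le hsF0.le]
        apply Real.one_le_rpow _ (by linarith)
        rw [← mul_div_assoc, one_le_div hF0]
        nlinarith
      have h4 : 1 ≤ (Vm / V) * (Fm ^ (γ + 1) * (s / F) ^ (γ + 1)) := one_le_mul_of_one_le_of_one_le h1V h3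
      have hq : 0 ≤ C₀ * (s / F) := by positivity
      calc pD s x y ≤ c₆ * h 1 x y := hlarge hs1
        _ ≤ c₆ * (cH * Fm ^ γ * h s x y) := by gcongr
        _ ≤ c₆ * (cH * Fm ^ γ * h s x y) * ((Vm / V) * (Fm ^ (γ + 1) * (s / F) ^ (γ + 1))) :=
            le_mul_of_one_le_right (by positivity) h4
        _ = K2 / V * (h s x y * (0 + (s / F) ^ (γ + 1))) := by rw [hK2]; ring
        _ ≤ _ := by
            gcongr
            have : 0 < cu * (1 + K1) := by positivity
            linarith
  · intro hFs
    have hhF := hh0 F hF0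
    rcases le_total s 1 with hs1 | hs1
    · have hp := (hHK s x y hs hs1 hx hy).2
      have hrρ : r ≤ ρ := by
        by_contra hcon
        rw [not_le] at hcon
        have := hΦmono (Set.mem_Ici.2 hρ0.le) (Set.mem_Ici.2 hr.le) hcon
        rw [hρs] at this; linarith
      have h1 : (vol m x ρ)⁻¹ ≤ V⁻¹ := inv_anti₀ hV0 (vol_mono hm x hρ0 hrρ)
      have hcoef : 0 ≤ cu * h s x y := mul_nonneg hcu.le (hh0 s hs)
      refine hp.trans ((mul_le_mul_of_nonneg_left ((min_le_left _ _).trans h1) hcoef).trans ?_)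
      have h2 := hb1 x y hx hy F s hF0 hFs.le
      calc cu * h s x y * V⁻¹ ≤ cu * h F x y * V⁻¹ := by gcongr
        _ = cu / V * h F x y := by ring
        _ ≤ _ := by
          gcongr
          nlinarith
    · have h2 : h 1 x y ≤ (1 + cH * Fm ^ γ) * h F x y := by
        have hq : 0 ≤ cH * Fm ^ γ * h F x y := by positivity
        rcases le_total F 1 with hF1 | hF1
        · have := hb1 x y hx hy F 1 hF0 hF1
          nlinarith
        · have h1 := hb2 x y hx hy 1 F one_pos hF1 (hhor F hFFm)
          rw [Real.one_rpow, one_mul] at h1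
          have hsFm : F ^ γ ≤ Fm ^ γ := Real.rpow_le_rpow hF0.le hFFm' hγ
          have : cH * (F ^ γ * h F x y) ≤ cH * Fm ^ γ * h F x y := by
            rw [mul_assoc]; gcongr
          nlinarith
      calc pD s x y ≤ c₆ * h 1 x y := hlarge hs1
        _ ≤ c₆ * ((1 + cH * Fm ^ γ) * h F x y) := by gcongr
        _ ≤ c₆ * ((1 + cH * Fm ^ γ) * h F x y) * (Vm / V) :=
            le_mul_of_one_le_right (by positivity) h1V
        _ = K3 / V * h F x y := by rw [hK3]; ring
        _ ≤ _ := by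
            gcongr
            have : 0 < cu * (1 + K1) := by positivity
            linarith

set_option maxHeartbeats 4000000 in
lemma pD_low
    {E : Type*} [MetricSpace E] [MeasurableSpace E]
    (m : Measure E) (R_E : ℝ≥0∞) (d₁ d₂ : ℝ)
    (hm : ∀ (x : E) (r : ℝ), 0 < r → 0 < m (Metric.ball x r) ∧ m (Metric.ball x r) < ⊤)
    (hRE : 0 < R_E) (hd₂ : 0 ≤ d₂) (hVD : VolDoubling m R_E d₁ d₂)
    (D : Set E) (hDne : D.Nonempty)
    (Φ Ψ : ℝ → ℝ) (cA cA' α₁ α₂ : ℝ)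
    (hΦ0 : Φ 0 = 0) (hΦmono : StrictMonoOn Φ (Set.Ici 0))
    (hΦΨ : ∀ r : ℝ, 0 ≤ r → Φ r ≤ Ψ r)
    (hcA : 0 < cA) (hα₁ : 0 < α₁)
    (hΦsc : WeakScaling Φ cA cA' α₁ α₂)
    (ΦInv : ℝ → ℝ) (hΦInv : ∀ s : ℝ, 0 < s → 0 < ΦInv s ∧ Φ (ΦInv s) = s)
    (h : ℝ → E → E → ℝ) (cH γ : ℝ) (hcH : 0 < cH) (hγ : 0 ≤ γ)
    (pD : ℝ → E → E → ℝ)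
    (C₀ cl cexl cu cexu : ℝ) (hC₀ : 0 ≤ C₀)
    (hcl : 0 < cl) (hcexl : 0 < cexl)
    (hDbdd : Bornology.IsBounded D)
    (hcomp : ∃ k : ℝ, 0 < k ∧ ∀ r : ℝ, 0 < r → r ≤ Metric.diam D → Ψ r ≤ k * Φ r)
    (hbf : IsBoundaryFunction D h (ENNReal.ofReal (4 * Φ (Metric.diam D) + 1)) cH γ)
    (hHK : HKest m D Ψ ΦInv h pD C₀ cl cexl cu cexu (fun t => t ≤ 1))
    (lamD c₅ c₆ : ℝ) (hlamD : 0 < lamD) (hc₅ : 0 < c₅)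
    (hHKlarge : HKlarge D h pD lamD c₅ c₆) (ε K : ℝ) (hε : 0 < ε) (hK : 1 < K) :
    ∃ c : ℝ, 0 < c ∧ ∀ x y : E, x ∈ D → y ∈ D → 0 < dist x y → ∀ u s : ℝ, 0 < u →
      u ≤ 4 * Φ (dist x y) → ε * u ≤ s → s ≤ K * u → (C₀ = 1 ∨ u = Φ (dist x y)) →
      c / vol m x (dist x y) * (h u x y * (u / Φ (dist x y))) ≤ pD s x y := by
  obtain ⟨hb01, hb1, hb2⟩ := hbf
  obtain ⟨k, hk, hcomp⟩ := hcomp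
  set d := Metric.diam D with hd
  have hK0 : 0 < K := by linarith
  set L := max 1 ((4 * K / cA) ^ (α₁⁻¹)) with hL
  have hL1 : 1 ≤ L := le_max_left _ _
  have hL0 : 0 < L := by linarith
  set L2 := max 1 ((1 / (ε * cA)) ^ (α₁⁻¹)) with hL2
  have hL21 : 1 ≤ L2 := le_max_left _ _
  have hL20 : 0 < L2 := by linarith
  obtain ⟨CV, hCV, HV⟩ := vol_doub hm hRE hVD (L * d)
  have hr1 := hΦInv (1 / (4 * K)) (by positivity)
  obtain ⟨Vm, hVm, HVm⟩ := vol_min hm hRE hVD hDbdd hDne hr1.1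
  -- constants
  set kh := min 1 (1 / (cH * K ^ γ)) with hkh
  have hkh0 : 0 < kh := lt_min one_pos (by positivity)
  set kA := 1 / (CV * L ^ d₂) with hkA
  have hkA0 : 0 < kA := by positivity
  set kx := Real.exp (-(cexl * L2 ^ 2)) with hkx
  have hkx0 : 0 < kx := Real.exp_pos _
  have hkx1 : kx ≤ 1 := by rw [hkx, Real.exp_le_one_iff]; have : 0 < cexl * L2 ^ 2 := by positivity
                           linarith
  set km := min (kA / 4) (min (ε / k) (kA * kx)) with hkm
  have hkm0 : 0 < km := lt_min (by positivity) (lt_min (by positivity) (by positivity))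
  set kl := c₅ * Real.exp (-(lamD * (4 * K * Φ d))) * kh * Vm / 4 with hkl
  have hkl0 : 0 < kl := by positivity
  refine ⟨min (cl * kh * km) kl, lt_min (by positivity) hkl0,
    fun x y hx hy hr u s hu hu4 hs1 hs2 hcase => ?_⟩
  have hs : 0 < s := lt_of_lt_of_le (by positivity) hs1
  set r := dist x y with hrdef
  have hrd : r ≤ d := Metric.dist_le_diam_of_mem hDbdd hx hy
  have hd0 : 0 < d := hr.trans_le hrd
  set F := Φ r with hF
  have hF0 : 0 < F := phi_pos hΦ0 hΦmono hr
  have hFFm : F ≤ Φ d := hΦmono.monotoneOn hr.le hd0.le hrd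
  have hFd0 : 0 < Φ d := phi_pos hΦ0 hΦmono hd0
  set V := vol m x r with hV
  have hV0 : 0 < V := vol_pos hm x hr
  have hh0 : ∀ u : ℝ, 0 < u → 0 ≤ h u x y := fun u hu => (hb01 u x y hu hx hy).1
  have hhu := hh0 u hu
  -- comparison of h
  have hhs : ∀ v : ℝ, 0 < v → v ≤ 1 → v ≤ K * u → kh * h u x y ≤ h v x y := by
    intro v hv hv1 hvu
    rcases le_total v u with hle | hle
    · have := hb1 x y hx hy v u hv hle
      have : kh * h u x y ≤ 1 * h u x y := by gcongr; exact min_le_left _ _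
      linarith
    · have h1 := hb2 x y hx hy u v hu hle (by
        apply (ENNReal.ofReal_lt_ofReal_iff (by positivity)).2
        linarith)
      have hv' : v ^ γ ≤ K ^ γ * u ^ γ := by
        rw [← Real.mul_rpow hK0.le hu.le]
        exact Real.rpow_le_rpow hv.le hvu hγ
      have hup : 0 < u ^ γ := by positivity
      have hhv := hh0 v hv
      have h2 : u ^ γ * h u x y ≤ u ^ γ * (cH * K ^ γ * h v x y) := by
        calc u ^ γ * h u x y ≤ cH * (v ^ γ * h v x y) := h1
          _ ≤ cH * (K ^ γ * u ^ γ * h v x y) := by gcongr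
          _ = _ := by ring
      have h3 := le_of_mul_le_mul_left h2 hup
      calc kh * h u x y ≤ 1 / (cH * K ^ γ) * h u x y := by gcongr; exact min_le_right _ _
        _ ≤ 1 / (cH * K ^ γ) * (cH * K ^ γ * h v x y) := by gcongr
        _ = h v x y := by field_simp
  have huF : u / F ≤ 4 := by rwa [div_le_iff₀ hF0]
  have huF0 : 0 < u / F := by positivity
  rcases le_total s 1 with hs1' | hs1'
  · have hp := (hHK s x y hs hs1' hx hy).1
    obtain ⟨hρ0, hρs⟩ := hΦInv s hs
    set ρ := ΦInv s with hρ
    have hvρ := vol_pos hm x hρ0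
    have hsF : s / F ≤ 4 * K := by
      rw [div_le_iff₀ hF0]; nlinarith
    have hA : kA / V ≤ (vol m x ρ)⁻¹ := by
      have hvol : vol m x ρ ≤ CV * L ^ d₂ * V := by
        rcases le_total ρ r with hle | hle
        · have h1 := vol_mono hm x hr hle
          have h2 : 1 ≤ CV * L ^ d₂ :=
            one_le_mul_of_one_le_of_one_le hCV (Real.one_le_rpow hL1 hd₂)
          nlinarith
        · have h1 := (hΦsc r ρ hr hle).1
          rw [hρs] at h1
          have h2 : (ρ / r) ^ α₁ ≤ 4 * K / cA := by
            rw [le_div_iff₀ hcA]; linarith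
          have h3 : ρ / r ≤ L := by
            have := Real.rpow_le_rpow (by positivity) h2 (inv_nonneg.2 hα₁.le)
            rw [Real.rpow_rpow_inv (by positivity) hα₁.ne'] at this
            exact this.trans (le_max_right _ _)
          have h4 : ρ ≤ L * d := by
            rw [div_le_iff₀ hr] at h3
            exact h3.trans (by gcongr)
          refine (HV x r ρ hr hle h4).trans ?_
          have : (ρ / r) ^ d₂ ≤ L ^ d₂ := Real.rpow_le_rpow (by positivity) h3 hd₂
          gcongr
      rw [hkA, le_inv_comm₀ (by positivity) hvρ]
      refine hvol.trans (le_of_eq ?_)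
      field_simp
    have hmin : km / V * (u / F) ≤ min ((vol m x ρ)⁻¹) (C₀ * s / (V * Ψ r) +
          (vol m x ρ)⁻¹ * Real.exp (-(cexl * r ^ 2 / ρ ^ 2))) := by
      have hΨ0 : 0 < Ψ r := hF0.trans_le (hΦΨ r hr.le)
      apply le_min
      · calc km / V * (u / F) ≤ (kA / 4) / V * 4 := by
              gcongr
              exact min_le_left _ _
          _ = kA / V := by ring
          _ ≤ _ := hA
      · rcases hcase with hcase | hcase
        · rw [hcase, one_mul]
          have h1 : ε * u / (V * (k * F)) ≤ s / (V * Ψ r) := by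
            gcongr
            exact hcomp r hr hrd
          have h2 : 0 < (vol m x ρ)⁻¹ * Real.exp (-(cexl * r ^ 2 / ρ ^ 2)) := by positivity
          calc km / V * (u / F) ≤ (ε / k) / V * (u / F) := by
                gcongr
                exact (min_le_right _ _).trans (min_le_left _ _)
            _ = ε * u / (V * (k * F)) := by field_simp
            _ ≤ _ := by linarith
        · have huF1 : u / F = 1 := by rw [hcase]; exact div_self hF0.ne'
          have hrρ : r / ρ ≤ L2 := by
            rcases le_total r ρ with hle | hle
            · exact ((div_le_one hρ0).2 hle).trans hL21
            · have h1 := (hΦsc ρ r hρ0 hle).1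
              rw [hρs] at h1
              have h1' : Φ r / s ≤ 1 / ε := by
                rw [div_le_div_iff₀ hs hε, one_mul, mul_comm, ← hF, ← hcase]; exact hs1
              have h2 : (r / ρ) ^ α₁ ≤ 1 / (ε * cA) := by
                have e : 1 / (ε * cA) = (1 / ε) / cA := by field_simp
                rw [e, le_div_iff₀ hcA]; linarith
              have := Real.rpow_le_rpow (by positivity) h2 (inv_nonneg.2 hα₁.le)
              rw [Real.rpow_rpow_inv (by positivity) hα₁.ne'] at this
              exact this.trans (le_max_right _ _)
          have hex : kx ≤ Real.exp (-(cexl * r ^ 2 / ρ ^ 2)) := by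
            apply Real.exp_le_exp.2
            have e : cexl * r ^ 2 / ρ ^ 2 = cexl * (r / ρ) ^ 2 := by rw [div_pow]; ring
            rw [e]
            have : cexl * (r / ρ) ^ 2 ≤ cexl * L2 ^ 2 := by gcongr
            linarith
          have h2 : 0 ≤ C₀ * s / (V * Ψ r) := by positivity
          calc km / V * (u / F) ≤ (kA * kx) / V * (u / F) := by
                gcongr
                exact (min_le_right _ _).trans (min_le_right _ _)
            _ = kA / V * kx := by rw [huF1]; ring
            _ ≤ (vol m x ρ)⁻¹ * Real.exp (-(cexl * r ^ 2 / ρ ^ 2)) := by gcongr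
            _ ≤ _ := by linarith
    refine le_trans ?_ hp
    have hhs' := hhs s hs hs1' hs2
    calc min (cl * kh * km) kl / V * (h u x y * (u / F))
        ≤ (cl * kh * km) / V * (h u x y * (u / F)) := by gcongr; exact min_le_left _ _
      _ = cl * (kh * h u x y) * (km / V * (u / F)) := by ring
      _ ≤ _ := by
        have := hh0 s hs
        apply mul_le_mul _ hmin (by positivity) (by positivity)
        gcongr
  · have hp := (hHKlarge s x y hs1' hx hy).1
    have h1u : 1 ≤ K * u := hs1'.trans hs2
    have hhs' := hhs 1 one_pos le_rfl h1u
    have hK4 : 1 ≤ K * (4 * F) := h1u.trans (by gcongr)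
    have hrr : ΦInv (1 / (4 * K)) ≤ r := by
      by_contra hcon
      rw [not_le] at hcon
      have := hΦmono (Set.mem_Ici.2 hr.le) (Set.mem_Ici.2 hr1.1.le) hcon
      rw [hr1.2, lt_div_iff₀ (by positivity)] at this
      rw [← hF] at this
      linarith
    have hVV := HVm x hx r hrr
    have hsK : s ≤ 4 * K * Φ d := by
      calc s ≤ K * u := hs2
        _ ≤ K * (4 * F) := by gcongr
        _ ≤ K * (4 * Φ d) := by gcongr
        _ = _ := by ring
    have hex : Real.exp (-(lamD * (4 * K * Φ d))) ≤ Real.exp (-(lamD * s)) := by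
      apply Real.exp_le_exp.2
      have : lamD * s ≤ lamD * (4 * K * Φ d) := by gcongr
      linarith
    have hVV1 : Vm / V ≤ 1 := by rwa [div_le_one hV0]
    have hh1 := hh0 1 one_pos
    refine le_trans ?_ hp
    calc min (cl * kh * km) kl / V * (h u x y * (u / F))
        ≤ kl / V * (h u x y * 4) := by gcongr; exact min_le_right _ _
      _ = c₅ * Real.exp (-(lamD * (4 * K * Φ d))) * (kh * h u x y) * (Vm / V) := by
          rw [hkl]; ring
      _ ≤ c₅ * Real.exp (-(lamD * (4 * K * Φ d))) * (kh * h u x y) * 1 := by gcongr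
      _ ≤ c₅ * Real.exp (-(lamD * s)) * h 1 x y := by
          rw [mul_one]; gcongr

open MeasureTheory Real Set
open scoped ENNReal

lemma up0 {ν : Measure ℝ} {μ : ℝ → Measure ℝ} (hsub : IsSubordinatorLaw ν μ)
    {φInv : ℝ → ℝ} (hφ : IsPhiInv ν φInv) {t F A : ℝ} (ht : 0 < t) (hF : 0 < F) (hA : 0 ≤ A)
    {p : ℝ → ℝ} (hp : ∀ s, 0 < s → p s ≤ A * min 1 (s / F)) :
    ∫⁻ s, ENNReal.ofReal (p s) ∂(μ t) ≤ ENNReal.ofReal (A * (2 * (t * laplaceExp ν F⁻¹))) := by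
  have h1 : ∫⁻ s, ENNReal.ofReal (p s) ∂(μ t) ≤ ∫⁻ s, ENNReal.ofReal (A * min 1 (s / F)) ∂(μ t) := by
    apply lintegral_mono_ae
    filter_upwards [sub_ae_pos hsub hφ ht] with s hs
    exact ENNReal.ofReal_le_ofReal (hp s hs)
  refine h1.trans ?_
  rw [← ofReal_integral_eq_lintegral_ofReal ((sub_min_integrable hsub ht hF).const_mul A) (by
    filter_upwards [sub_ae_nonneg hsub ht] with s hs
    exact mul_nonneg hA (le_min zero_le_one (by positivity))), integral_const_mul]
  exact ENNReal.ofReal_le_ofReal (mul_le_mul_of_nonneg_left (sub_min_le hsub ht hF) hA)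

lemma low0 {μ : Measure ℝ} [IsProbabilityMeasure μ] {A b1 b2 : ℝ} (hA : 0 ≤ A)
    {p : ℝ → ℝ} (hp : ∀ s ∈ Set.Icc b1 b2, A ≤ p s) :
    ENNReal.ofReal (A * μ.real (Set.Icc b1 b2)) ≤ ∫⁻ s, ENNReal.ofReal (p s) ∂μ := by
  rw [ENNReal.ofReal_mul hA, measureReal_def, ENNReal.ofReal_toReal (measure_ne_top _ _),
    ← setLIntegral_const]
  refine le_trans ?_ (setLIntegral_le_lintegral (Set.Icc b1 b2) _)
  exact setLIntegral_mono' measurableSet_Icc fun s hs => ENNReal.ofReal_le_ofReal (hp s hs)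

/-- `∫_{2a}^{4F} g w` -/
noncomputable def Bint (ν : Measure ℝ) (g : ℝ → ℝ) (a F : ℝ) : ℝ :=
  ∫ s in Set.Ioc (2 * a) (4 * F), g s * levyTail ν s

lemma tail_antitone_max {ν : Measure ℝ} (hν : IsLevyMeasure ν) {b : ℝ} (hb : 0 < b) :
    Antitone fun u => levyTail ν (max b u) := fun _ _ huv =>
  tail_anti hν (lt_max_of_lt_left hb) (max_le_max le_rfl huv)

lemma Bint_integrable {ν : Measure ℝ} (hν : IsLevyMeasure ν) {g : ℝ → ℝ} (hg : Antitone g)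
    (hg0 : ∀ s, 0 ≤ g s) (hg1 : ∀ s, g s ≤ 1) {a F : ℝ} (ha : 0 < a) :
    IntegrableOn (fun s => g s * levyTail ν s) (Set.Ioc (2 * a) (4 * F)) := by
  have h2a : 0 < 2 * a := by positivity
  have h1 : IntegrableOn (fun s => g s * levyTail ν (max (2 * a) s)) (Set.Ioc (2 * a) (4 * F)) := by
    refine Measure.integrableOn_of_bounded (M := levyTail ν (2 * a)) (by simp)
      (hg.measurable.mul (tail_antitone_max hν h2a).measurable).aestronglyMeasurable ?_
    refine Filter.Eventually.of_forall fun s => ?_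
    rw [Real.norm_of_nonneg (mul_nonneg (hg0 s) (tail_nonneg _))]
    have h2 := tail_anti hν h2a (le_max_left (2 * a) s)
    have h3 : 0 ≤ levyTail ν (max (2 * a) s) := tail_nonneg _
    calc g s * levyTail ν (max (2 * a) s) ≤ 1 * levyTail ν (max (2 * a) s) := by
          gcongr; exact hg1 s
      _ ≤ _ := by linarith
  refine h1.congr_fun (fun s hs => ?_) measurableSet_Ioc
  simp only [max_eq_right hs.1.le]

lemma Bint_lintegral {ν : Measure ℝ} (hν : IsLevyMeasure ν) {g : ℝ → ℝ} (hg : Antitone g)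
    (hg0 : ∀ s, 0 ≤ g s) (hg1 : ∀ s, g s ≤ 1) {a F : ℝ} (ha : 0 < a) :
    ENNReal.ofReal (Bint ν g a F) =
      ∫⁻ s in Set.Ioc (2 * a) (4 * F), ENNReal.ofReal (g s * levyTail ν s) :=
  ofReal_integral_eq_lintegral_ofReal (Bint_integrable hν hg hg0 hg1 ha)
    (Filter.Eventually.of_forall fun s => mul_nonneg (hg0 s) (tail_nonneg s))

lemma Bint_low {ν : Measure ℝ} (hν : IsLevyMeasure ν) {R₁ : ℝ≥0∞} {c c' β₁ β₂ : ℝ}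
    (hc : 0 < c) (hc' : 0 < c') (hβ₂0 : 0 < β₂) (hβ₂ : β₂ < 1)
    (hp : PolyCond ν R₁ c c' β₁ β₂) {cH γ : ℝ} (hcH : 0 < cH) :
    ∃ κ : ℝ, 0 < κ ∧ ∀ (g : ℝ → ℝ) (a F v : ℝ), Antitone g → (∀ s, 0 ≤ g s) → (∀ s, g s ≤ 1) →
      0 < a → a ≤ v → v ≤ F → ENNReal.ofReal (4 * F) < R₁ →
      (∀ s t, 0 < s → s ≤ t → t ≤ 4 * F → s ^ γ * g s ≤ cH * (t ^ γ * g t)) →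
      κ * (v * g v * laplaceExp ν v⁻¹) ≤ Bint ν g a F := by
  set Cφ := c' / (1 - β₂) with hCφ
  have hCφ0 : 0 < Cφ := div_pos hc' (by linarith)
  refine ⟨2 / (cH * 4 ^ γ * (Cφ * (c' * 4 ^ β₂))), by positivity,
    fun g a F v hg hg0 hg1 ha hav hvF hFR hH2 => ?_⟩
  have hv : 0 < v := ha.trans_le hav
  have h4v : 0 < 4 * v := by positivity
  have h4vR : ENNReal.ofReal (4 * v) < R₁ :=
    (ENNReal.ofReal_le_ofReal (by linarith)).trans_lt hFR
  have hvR : ENNReal.ofReal v < R₁ :=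
    (ENNReal.ofReal_le_ofReal (by linarith)).trans_lt h4vR
  have h1 : 2 * v * (g (4 * v) * levyTail ν (4 * v)) ≤ Bint ν g a F := by
    have hsubset : Set.Ioc (2 * v) (4 * v) ⊆ Set.Ioc (2 * a) (4 * F) :=
      Set.Ioc_subset_Ioc (by linarith) (by linarith)
    have hI := Bint_integrable (F := F) hν hg hg0 hg1 ha
    have h2 : ∫ s in Set.Ioc (2 * v) (4 * v), g s * levyTail ν s ≤ Bint ν g a F := by
      refine setIntegral_mono_set hI ?_ hsubset.eventuallyLE
      exact Filter.Eventually.of_forall fun s => mul_nonneg (hg0 s) (tail_nonneg s)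
    refine le_trans ?_ h2
    have h3 : ∫ _ in Set.Ioc (2 * v) (4 * v), g (4 * v) * levyTail ν (4 * v) =
        2 * v * (g (4 * v) * levyTail ν (4 * v)) := by
      rw [setIntegral_const, smul_eq_mul, Real.volume_real_Ioc_of_le (by linarith)]; ring
    rw [← h3]
    refine setIntegral_mono_on (integrableOn_const (by simp)) (hI.mono_set hsubset)
      measurableSet_Ioc fun s hs => ?_
    have hs0 : 0 < s := lt_trans (by positivity) hs.1
    exact mul_le_mul (hg hs.2) (tail_anti hν hs0 hs.2) (tail_nonneg _) (hg0 s)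
  refine le_trans ?_ h1
  have h2 : g v ≤ cH * 4 ^ γ * g (4 * v) := by
    have := hH2 v (4 * v) hv (by linarith) (by linarith)
    rw [Real.mul_rpow (by norm_num) hv.le] at this
    have hvp : 0 < v ^ γ := by positivity
    refine le_of_mul_le_mul_left (this.trans (le_of_eq ?_)) hvp
    ring
  have h3 : laplaceExp ν v⁻¹ ≤ Cφ * (c' * 4 ^ β₂) * levyTail ν (4 * v) := by
    have h4 := lap_le_tail hν hc hc' hβ₂0 hβ₂ hp hv hvR
    have h5 := poly_up hc hp hv (by linarith : v ≤ 4 * v) h4vR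
    have e : 4 * v / v = 4 := by field_simp
    rw [e] at h5
    refine h4.trans ?_
    rw [mul_assoc]
    gcongr
  have hw : 0 ≤ levyTail ν (4 * v) := tail_nonneg _
  have hgg := hg0 v
  have hgg4 := hg0 (4 * v)
  have hl0 : 0 ≤ laplaceExp ν v⁻¹ := by
    have := lap_ge_tail hν hv
    have : 0 ≤ levyTail ν v := tail_nonneg _
    linarith
  calc 2 / (cH * 4 ^ γ * (Cφ * (c' * 4 ^ β₂))) * (v * g v * laplaceExp ν v⁻¹)
      ≤ 2 / (cH * 4 ^ γ * (Cφ * (c' * 4 ^ β₂))) * (v * (cH * 4 ^ γ * g (4 * v)) *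
        (Cφ * (c' * 4 ^ β₂) * levyTail ν (4 * v))) := by gcongr
    _ = _ := by field_simp

lemma up1 {ν : Measure ℝ} {μ : ℝ → Measure ℝ} (hsub : IsSubordinatorLaw ν μ)
    {φInv : ℝ → ℝ} (hφ : IsPhiInv ν φInv)
    {R₁ : ℝ≥0∞} {c c' β₁ β₂ : ℝ}
    (hc : 0 < c) (hc' : 0 < c') (hβ₁ : 0 < β₁) (hβ₂0 : 0 < β₂) (hβ₂ : β₂ < 1)
    (hp : PolyCond ν R₁ c c' β₁ β₂) {cH γ : ℝ} (hcH : 0 < cH) (hγ : 0 ≤ γ) :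
    ∃ C : ℝ, 0 < C ∧ ∀ (g p : ℝ → ℝ) (t a F B : ℝ), Antitone g → (∀ s, 0 ≤ g s) →
      (∀ s, g s ≤ 1) → 0 < t → 0 ≤ B →
      0 < a → a ≤ F → ENNReal.ofReal (4 * F) < R₁ → t * laplaceExp ν a⁻¹ = 1 →
      (∀ s t, 0 < s → s ≤ t → t ≤ 4 * F → s ^ γ * g s ≤ cH * (t ^ γ * g t)) →
      (∀ s, 0 < s → s ≤ F → p s ≤ B * (g s * (2 * (s / F)))) →
      (∀ s, F < s → p s ≤ B * g F) →
      ∫⁻ s, ENNReal.ofReal (p s) ∂(μ t) ≤ ENNReal.ofReal (C * (B * (t * Bint ν g a F / F))) := by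
  have hν := hsub.levy
  obtain ⟨κ, hκ, Hlow⟩ := Bint_low hν hc hc' hβ₂0 hβ₂ hp (cH := cH) (γ := γ) hcH
  obtain ⟨CM, hCM, HM⟩ := sub_neg_moment hsub hφ hc hc' hβ₁ hβ₂0 hβ₂ hp hγ
  set Cφ := c' / (1 - β₂) with hCφ
  have hCφ0 : 0 < Cφ := div_pos hc' (by linarith)
  set k1 := cH * 2 ^ γ with hk1
  have hk10 : 0 < k1 := by positivity
  refine ⟨4 * (k1 * CM + 1) / κ + 4 * Cφ + 2 / κ, by positivity,
    fun g p t a F B hg hg0 hg1 ht hB ha haF hFR hta hH2 hp1 hp2 => ?_⟩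
  have := hsub.prob t ht
  have hF : 0 < F := ha.trans_le haF
  have haR : ENNReal.ofReal a < R₁ := (ENNReal.ofReal_le_ofReal (by linarith)).trans_lt hFR
  have hgm : Measurable g := hg.measurable
  -- the kernel
  let kk : ℝ → ℝ → ℝ≥0∞ := fun s u => ({q : ℝ × ℝ | q.2 < q.1}).indicator
    (fun q => ENNReal.ofReal (g q.2)) (s, u)
  have hkm : Measurable (Function.uncurry kk) := by
    have : Function.uncurry kk = ({q : ℝ × ℝ | q.2 < q.1}).indicator
      (fun q => ENNReal.ofReal (g q.2)) := by ext ⟨s, u⟩; rfl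
    rw [this]
    exact ((hgm.comp measurable_snd).ennreal_ofReal).indicator
      (measurableSet_lt measurable_snd measurable_fst)
  set Z := 2 * a * g (2 * a) with hZ
  have hZ0 : 0 ≤ Z := mul_nonneg (by positivity) (hg0 _)
  have hpt : ∀ᵐ s ∂(μ t), ENNReal.ofReal (p s) ≤
      ENNReal.ofReal (B * (2 / F) * Z) * (ENNReal.ofReal k1 * ENNReal.ofReal ((a / s) ^ γ) + 1) +
      (ENNReal.ofReal (B * (2 / F)) * ∫⁻ u in Set.Ioc (2 * a) (4 * F), kk s u) +
      ENNReal.ofReal (B * g F * min 1 (s / F)) := by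
    filter_upwards [sub_ae_pos hsub hφ ht] with s hs
    rcases lt_or_ge F s with hFs | hsF
    · refine le_trans ?_ le_add_self
      apply ENNReal.ofReal_le_ofReal
      have : min 1 (s / F) = 1 := min_eq_left (by rw [one_le_div hF]; exact hFs.le)
      rw [this, mul_one]; exact hp2 s hFs
    refine le_trans ?_ le_self_add
    have hps := hp1 s hs hsF
    have e0 : B * (g s * (2 * (s / F))) = B * (2 / F) * (g s * s) := by ring
    rw [e0] at hps
    have hBF : 0 ≤ B * (2 / F) := by positivity
    rcases le_total s (2 * a) with hsa | hsa
    · refine le_trans ?_ le_self_add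
      have h1 := hH2 s (2 * a) hs hsa (by linarith)
      have hsp : 0 < s ^ γ := by positivity
      have h2 : g s ≤ k1 * (a / s) ^ γ * g (2 * a) := by
        rw [Real.mul_rpow (by norm_num) ha.le] at h1
        rw [Real.div_rpow ha.le hs.le]
        have : k1 * (a ^ γ / s ^ γ) * g (2 * a) = cH * (2 ^ γ * a ^ γ * g (2 * a)) / s ^ γ := by
          rw [hk1]; ring
        rw [this, le_div_iff₀ hsp]; linarith
      have h3 : g s * s ≤ Z * (k1 * (a / s) ^ γ) := by
        have hb' : 0 ≤ k1 * (a / s) ^ γ * g (2 * a) := (hg0 s).trans h2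
        calc g s * s ≤ (k1 * (a / s) ^ γ * g (2 * a)) * (2 * a) := by gcongr
          _ = _ := by rw [hZ]; ring
      calc ENNReal.ofReal (p s) ≤ ENNReal.ofReal (B * (2 / F) * Z * (k1 * (a / s) ^ γ)) := by
            apply ENNReal.ofReal_le_ofReal
            refine hps.trans ?_
            rw [mul_assoc _ Z]
            gcongr
        _ = ENNReal.ofReal (B * (2 / F) * Z) * (ENNReal.ofReal k1 * ENNReal.ofReal ((a / s) ^ γ)) := by
            rw [ENNReal.ofReal_mul (by positivity), ENNReal.ofReal_mul hk10.le]
        _ ≤ _ := by gcongr; exact le_self_add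
    · have h1 : g s * s ≤ Z + g s * (s - 2 * a) := by
        have : g s ≤ g (2 * a) := hg hsa
        rw [hZ]; nlinarith
      have h2 : ENNReal.ofReal (g s * (s - 2 * a)) ≤
          ∫⁻ u in Set.Ioc (2 * a) (4 * F), kk s u := by
        calc ENNReal.ofReal (g s * (s - 2 * a)) =
            ∫⁻ _ in Set.Ioo (2 * a) s, ENNReal.ofReal (g s) := by
              rw [setLIntegral_const, Real.volume_Ioo, ENNReal.ofReal_mul (hg0 s)]
          _ ≤ ∫⁻ u in Set.Ioo (2 * a) s, kk s u := by
              refine setLIntegral_mono' measurableSet_Ioo fun u hu => ?_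
              have : kk s u = ENNReal.ofReal (g u) := by
                simp only [kk]
                exact Set.indicator_of_mem (show (s, u) ∈ {q : ℝ × ℝ | q.2 < q.1} from hu.2) _
              rw [this]
              exact ENNReal.ofReal_le_ofReal (hg hu.2.le)
          _ ≤ _ := by
              apply lintegral_mono_set
              intro u hu
              exact ⟨hu.1, by linarith [hu.2]⟩
      calc ENNReal.ofReal (p s) ≤ ENNReal.ofReal (B * (2 / F) * Z + B * (2 / F) * (g s * (s - 2 * a))) := by
            apply ENNReal.ofReal_le_ofReal
            refine hps.trans ?_
            rw [← mul_add]
            gcongr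
        _ = ENNReal.ofReal (B * (2 / F) * Z) + ENNReal.ofReal (B * (2 / F)) *
              ENNReal.ofReal (g s * (s - 2 * a)) := by
            have hgs0 := hg0 s
            have hsa0 : 0 ≤ s - 2 * a := by linarith
            have hnn : 0 ≤ B * (2 / F) * (g s * (s - 2 * a)) := by positivity
            rw [ENNReal.ofReal_add (by positivity) hnn,
              ENNReal.ofReal_mul (q := g s * (s - 2 * a)) hBF]
        _ ≤ _ := by
            gcongr
            calc ENNReal.ofReal (B * (2 / F) * Z) = ENNReal.ofReal (B * (2 / F) * Z) * 1 := by rw [mul_one]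
              _ ≤ _ := by gcongr; exact le_add_self
  refine (lintegral_mono_ae hpt).trans ?_
  have hm1 : Measurable fun s : ℝ => ENNReal.ofReal (B * (2 / F) * Z) *
      (ENNReal.ofReal k1 * ENNReal.ofReal ((a / s) ^ γ) + 1) := by fun_prop
  have hm2 : Measurable fun s : ℝ => ENNReal.ofReal (B * (2 / F)) *
      ∫⁻ u in Set.Ioc (2 * a) (4 * F), kk s u :=
    (Measurable.lintegral_prod_right (ν := volume.restrict (Set.Ioc (2 * a) (4 * F))) hkm).const_mul _
  have hm12 : Measurable fun s : ℝ => ENNReal.ofReal (B * (2 / F) * Z) *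
      (ENNReal.ofReal k1 * ENNReal.ofReal ((a / s) ^ γ) + 1) +
      (ENNReal.ofReal (B * (2 / F)) * ∫⁻ u in Set.Ioc (2 * a) (4 * F), kk s u) := hm1.add hm2
  rw [lintegral_add_left hm12, lintegral_add_left hm1,
    lintegral_const_mul _ (by fun_prop), lintegral_add_right _ measurable_const,
    lintegral_const_mul _ (by fun_prop), lintegral_const, measure_univ, mul_one,
    lintegral_const_mul _ (Measurable.lintegral_prod_right (ν := volume.restrict (Set.Ioc (2 * a) (4 * F))) hkm),
    lintegral_lintegral_swap hkm.aemeasurable]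
  have hT1 : ENNReal.ofReal k1 * ∫⁻ s, ENNReal.ofReal ((a / s) ^ γ) ∂(μ t) + 1 ≤
      ENNReal.ofReal (k1 * CM + 1) := by
    rw [ENNReal.ofReal_add (by positivity) zero_le_one, ENNReal.ofReal_one,
      ENNReal.ofReal_mul hk10.le]
    gcongr
    exact HM t a ht ha haR hta
  have hT2 : ∫⁻ u in Set.Ioc (2 * a) (4 * F), ∫⁻ s, kk s u ∂(μ t) ≤
      ENNReal.ofReal (2 * Cφ * t * Bint ν g a F) := by
    rw [ENNReal.ofReal_mul (by positivity), Bint_lintegral hν hg hg0 hg1 ha,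
      ← lintegral_const_mul' _ _ ENNReal.ofReal_ne_top]
    refine setLIntegral_mono' measurableSet_Ioc fun u hu => ?_
    have hu0 : 0 < u := lt_trans (by positivity) hu.1
    have huR : ENNReal.ofReal u < R₁ := (ENNReal.ofReal_le_ofReal hu.2).trans_lt hFR
    have e1 : ∫⁻ s, kk s u ∂(μ t) = ENNReal.ofReal (g u) * (μ t) (Set.Ioi u) := by
      rw [← lintegral_indicator_const measurableSet_Ioi]
      congr 1
    rw [e1, ← ENNReal.ofReal_toReal (measure_ne_top (μ t) (Set.Ioi u)),
      ← ENNReal.ofReal_mul (hg0 u), ← ENNReal.ofReal_mul (by positivity)]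
    apply ENNReal.ofReal_le_ofReal
    have h1 := sub_tail_le hsub ht hu0
    have h2 := lap_le_tail hν hc hc' hβ₂0 hβ₂ hp hu0 huR
    have h3 := hg0 u
    calc g u * ((μ t) (Set.Ioi u)).toReal ≤ g u * (2 * (t * (Cφ * levyTail ν u))) := by
          gcongr
          exact h1.trans (by gcongr)
      _ = _ := by ring
  have hT3 : ∫⁻ s, ENNReal.ofReal (B * g F * min 1 (s / F)) ∂(μ t) ≤
      ENNReal.ofReal (B * g F * (2 * (t * laplaceExp ν F⁻¹))) :=
    up0 hsub hφ ht hF (mul_nonneg hB (hg0 F)) fun s _ => le_rfl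
  have hB1 := Hlow g a F a hg hg0 hg1 ha le_rfl haF hFR hH2
  have hB2 := Hlow g a F F hg hg0 hg1 ha haF le_rfl hFR hH2
  set I := Bint ν g a F with hI
  have hI0 : 0 ≤ I := setIntegral_nonneg measurableSet_Ioc fun s _ =>
    mul_nonneg (hg0 s) (tail_nonneg s)
  have hga := hg0 a
  have hgF := hg0 F
  have hZI : Z ≤ 2 / κ * (t * I) := by
    have h1 : a * g a = t * (a * g a * laplaceExp ν a⁻¹) := by
      calc a * g a = a * g a * (t * laplaceExp ν a⁻¹) := by rw [hta, mul_one]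
        _ = _ := by ring
    have h2 : κ * (a * g a) ≤ t * I := by
      rw [h1]
      calc κ * (t * (a * g a * laplaceExp ν a⁻¹)) = t * (κ * (a * g a * laplaceExp ν a⁻¹)) := by ring
        _ ≤ _ := by gcongr
    have h3 : g (2 * a) ≤ g a := hg (by linarith)
    calc Z ≤ 2 * a * g a := by rw [hZ]; gcongr
      _ = 2 / κ * (κ * (a * g a)) := by field_simp
      _ ≤ _ := by gcongr
  calc _ ≤ ENNReal.ofReal (B * (2 / F) * Z) * ENNReal.ofReal (k1 * CM + 1) +
        ENNReal.ofReal (B * (2 / F)) * ENNReal.ofReal (2 * Cφ * t * I) +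
        ENNReal.ofReal (B * g F * (2 * (t * laplaceExp ν F⁻¹))) := by gcongr
    _ = ENNReal.ofReal (B * (2 / F) * Z * (k1 * CM + 1) + B * (2 / F) * (2 * Cφ * t * I) +
        B * g F * (2 * (t * laplaceExp ν F⁻¹))) := by
        have := lap_nonneg hsub (l := F⁻¹) (by positivity)
        rw [← ENNReal.ofReal_mul (p := B * (2 / F) * Z) (q := k1 * CM + 1) (by positivity),
          ← ENNReal.ofReal_mul (p := B * (2 / F)) (q := 2 * Cφ * t * I) (by positivity),
          ← ENNReal.ofReal_add (by positivity) (by positivity),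
          ← ENNReal.ofReal_add (by positivity) (by positivity)]
    _ ≤ _ := by
        apply ENNReal.ofReal_le_ofReal
        have hgI : g F * laplaceExp ν F⁻¹ ≤ I / (κ * F) := by
          rw [le_div_iff₀ (by positivity)]; linarith
        calc B * (2 / F) * Z * (k1 * CM + 1) + B * (2 / F) * (2 * Cφ * t * I) +
              B * g F * (2 * (t * laplaceExp ν F⁻¹))
            = B * (2 / F) * Z * (k1 * CM + 1) + B * (2 / F) * (2 * Cφ * t * I) +
              B * (2 * t * (g F * laplaceExp ν F⁻¹)) := by ring
          _ ≤ B * (2 / F) * (2 / κ * (t * I)) * (k1 * CM + 1) + B * (2 / F) * (2 * Cφ * t * I) +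
              B * (2 * t * (I / (κ * F))) := by gcongr
          _ = _ := by field_simp; ring

lemma low1 {ν : Measure ℝ} {μ : ℝ → Measure ℝ} (hsub : IsSubordinatorLaw ν μ)
    {R₁ : ℝ≥0∞} {ε K k : ℝ} (hε : 0 < ε) (hK : 1 < K) (hk : 0 < k)
    (Hk : ∀ t u : ℝ, 0 < t → 0 < u →
      ENNReal.ofReal u < R₁ → t * laplaceExp ν u⁻¹ ≤ 1 →
      k * (t * laplaceExp ν u⁻¹) ≤ (μ t).real (Set.Icc (ε * u) (K * u)))
    (g p : ℝ → ℝ) (t a F b : ℝ) (hg : Antitone g) (hg0 : ∀ s, 0 ≤ g s)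
    (hg1 : ∀ s, g s ≤ 1) (ht : 0 < t) (hb : 0 < b) (ha : 0 < a) (hF : 0 < F)
    (hFR : ENNReal.ofReal (4 * F) < R₁) (hta : t * laplaceExp ν a⁻¹ = 1)
    (hp0 : ∀ s, 0 ≤ p s) (hpm : Measurable p)
    (hp1 : ∀ u s, 0 < u → u ≤ 4 * F → ε * u ≤ s → s ≤ K * u → b * (g u * (u / F)) ≤ p s) :
    ENNReal.ofReal (b * (ε * k / (2 * K)) * (t * Bint ν g a F / F)) ≤
      ∫⁻ s, ENNReal.ofReal (p s) ∂(μ t) := by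
  have hν := hsub.levy
  have := hsub.prob t ht
  have hK0 : 0 < K := by linarith
  have hgm : Measurable g := hg.measurable
  let A : Set (ℝ × ℝ) := {q : ℝ × ℝ | ε * q.2 ≤ q.1} ∩ {q : ℝ × ℝ | q.1 ≤ K * q.2}
  have hA : MeasurableSet A :=
    (measurableSet_le (by fun_prop) (by fun_prop)).inter (measurableSet_le (by fun_prop) (by fun_prop))
  let kk : ℝ → ℝ → ℝ≥0∞ := fun s u => A.indicator (fun q => ENNReal.ofReal (g q.2)) (s, u)
  have hkm : Measurable (Function.uncurry kk) := by
    have : Function.uncurry kk = A.indicator (fun q => ENNReal.ofReal (g q.2)) := by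
      ext ⟨s, u⟩; rfl
    rw [this]
    exact ((hgm.comp measurable_snd).ennreal_ofReal).indicator hA
  set I := Bint ν g a F with hI
  have hI0 : 0 ≤ I := setIntegral_nonneg measurableSet_Ioc fun s _ =>
    mul_nonneg (hg0 s) (tail_nonneg s)
  have h1 : ENNReal.ofReal (t * I) ≤
      ENNReal.ofReal (2 / k) * ∫⁻ u in Set.Ioc (2 * a) (4 * F), ∫⁻ s, kk s u ∂(μ t) := by
    rw [ENNReal.ofReal_mul ht.le, hI, Bint_lintegral hν hg hg0 hg1 ha,
      ← lintegral_const_mul' _ _ ENNReal.ofReal_ne_top,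
      ← lintegral_const_mul' _ _ ENNReal.ofReal_ne_top]
    refine setLIntegral_mono' measurableSet_Ioc fun u hu => ?_
    have hu0 : 0 < u := lt_trans (by positivity) hu.1
    have huR : ENNReal.ofReal u < R₁ := (ENNReal.ofReal_le_ofReal hu.2).trans_lt hFR
    have e1 : ∫⁻ s, kk s u ∂(μ t) = ENNReal.ofReal (g u) * (μ t) (Set.Icc (ε * u) (K * u)) := by
      rw [← lintegral_indicator_const measurableSet_Icc]
      congr 1
    rw [e1, ← ENNReal.ofReal_toReal (measure_ne_top (μ t) (Set.Icc (ε * u) (K * u))),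
      ← ENNReal.ofReal_mul (hg0 u), ← ENNReal.ofReal_mul (by positivity),
      ← ENNReal.ofReal_mul (by positivity)]
    apply ENNReal.ofReal_le_ofReal
    have hle : t * laplaceExp ν u⁻¹ ≤ 1 := by
      rw [← hta]
      have : a ≤ u := by linarith [hu.1]
      exact mul_le_mul_of_nonneg_left (lap_mono hν (by positivity) (inv_anti₀ ha this)) ht.le
    have h2 := Hk t u ht hu0 huR hle
    have h3 := lap_ge_tail hν hu0
    have h4 := hg0 u
    calc t * (g u * levyTail ν u) ≤ t * (g u * (2 * laplaceExp ν u⁻¹)) := by gcongr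
      _ = 2 / k * (g u * (k * (t * laplaceExp ν u⁻¹))) := by field_simp
      _ ≤ _ := by gcongr; exact h2
  rw [← lintegral_lintegral_swap hkm.aemeasurable] at h1
  have h2 : ∫⁻ s, (∫⁻ u in Set.Ioc (2 * a) (4 * F), kk s u) ∂(μ t) ≤
      ENNReal.ofReal (F * K / (b * ε)) * ∫⁻ s, ENNReal.ofReal (p s) ∂(μ t) := by
    rw [← lintegral_const_mul' _ _ ENNReal.ofReal_ne_top]
    refine lintegral_mono fun s => ?_
    rcases le_or_gt s 0 with hs | hs
    · have : ∫⁻ u in Set.Ioc (2 * a) (4 * F), kk s u = 0 := by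
        rw [setLIntegral_congr_fun measurableSet_Ioc (g := fun _ => 0), lintegral_zero]
        intro u hu
        have hu0 : 0 < u := lt_trans (by positivity) hu.1
        simp only [kk]
        apply Set.indicator_of_notMem
        intro hmem
        have : ε * u ≤ s := hmem.1
        have : 0 < ε * u := by positivity
        linarith
      rw [this]; exact zero_le
    · have hps := hp0 s
      calc ∫⁻ u in Set.Ioc (2 * a) (4 * F), kk s u
          ≤ ∫⁻ u in Set.Ioc (2 * a) (4 * F), (Set.Icc (s / K) (s / ε)).indicator
              (fun _ => ENNReal.ofReal (F * K / (b * s) * p s)) u := by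
            refine setLIntegral_mono' measurableSet_Ioc fun u hu => ?_
            have hu0 : 0 < u := lt_trans (by positivity) hu.1
            by_cases hmem : (s, u) ∈ A
            · have hm1 : ε * u ≤ s := hmem.1
              have hm2 : s ≤ K * u := hmem.2
              have e : kk s u = ENNReal.ofReal (g u) := Set.indicator_of_mem hmem _
              rw [e, Set.indicator_of_mem]
              · apply ENNReal.ofReal_le_ofReal
                have h3 := hp1 u s hu0 hu.2 hm1 hm2
                have h4 := hg0 u
                have h5 : s / K ≤ u := by rw [div_le_iff₀ hK0]; linarith
                have h6 : b * (g u * ((s / K) / F)) ≤ p s := le_trans (by gcongr) h3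
                calc g u = F * K / (b * s) * (b * (g u * ((s / K) / F))) := by field_simp
                  _ ≤ _ := by gcongr
              · refine ⟨by rw [div_le_iff₀ hK0]; linarith, by rw [le_div_iff₀ hε]; linarith⟩
            · have e : kk s u = 0 := Set.indicator_of_notMem hmem _
              rw [e]; exact zero_le
        _ ≤ ∫⁻ u, (Set.Icc (s / K) (s / ε)).indicator
              (fun _ => ENNReal.ofReal (F * K / (b * s) * p s)) u := setLIntegral_le_lintegral _ _
        _ = ENNReal.ofReal (F * K / (b * s) * p s) * ENNReal.ofReal (s / ε - s / K) := by
            rw [lintegral_indicator_const measurableSet_Icc, Real.volume_Icc]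
        _ ≤ ENNReal.ofReal (F * K / (b * s) * p s) * ENNReal.ofReal (s / ε) := by
            gcongr
            have : 0 < s / K := by positivity
            linarith
        _ = ENNReal.ofReal (F * K / (b * ε)) * ENNReal.ofReal (p s) := by
            rw [← ENNReal.ofReal_mul (by positivity), ← ENNReal.ofReal_mul (by positivity)]
            congr 1; field_simp
  calc ENNReal.ofReal (b * (ε * k / (2 * K)) * (t * I / F))
      = ENNReal.ofReal (b * (ε * k / (2 * K)) / F) * ENNReal.ofReal (t * I) := by
        rw [← ENNReal.ofReal_mul (by positivity)]; congr 1; ring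
    _ ≤ ENNReal.ofReal (b * (ε * k / (2 * K)) / F) * (ENNReal.ofReal (2 / k) *
          (ENNReal.ofReal (F * K / (b * ε)) * ∫⁻ s, ENNReal.ofReal (p s) ∂(μ t))) := by
        gcongr
        exact h1.trans (by gcongr)
    _ = ENNReal.ofReal (b * (ε * k / (2 * K)) / F * (2 / k * (F * K / (b * ε)))) *
          ∫⁻ s, ENNReal.ofReal (p s) ∂(μ t) := by
        rw [ENNReal.ofReal_mul (by positivity), ENNReal.ofReal_mul (by positivity)]; ring
    _ = _ := by
        have : b * (ε * k / (2 * K)) / F * (2 / k * (F * K / (b * ε))) = 1 := by field_simp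
        rw [this, ENNReal.ofReal_one, one_mul]

open MeasureTheory Real Set
open scoped ENNReal

lemma lap_strict {ν : Measure ℝ} (hν : IsLevyMeasure ν) {r : ℝ} (hr : 0 < levyTail ν r)
    {l l' : ℝ} (hl : 0 ≤ l) (hll : l < l') : laplaceExp ν l < laplaceExp ν l' := by
  have hi1 := lap_integrable hν hl
  have hi2 := lap_integrable hν (hl.trans hll.le)
  have hne : ν ≠ 0 := by
    rintro rfl
    simp [levyTail] at hr
  have hpos : ∀ s : ℝ, 0 < s →
      0 < (1 - Real.exp (-(l' * s))) - (1 - Real.exp (-(l * s))) := fun s hs => by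
    have : l * s < l' * s := by gcongr
    have := Real.exp_lt_exp.2 (neg_lt_neg this)
    linarith
  have h : 0 < ∫ s, ((1 - Real.exp (-(l' * s))) - (1 - Real.exp (-(l * s)))) ∂ν := by
    refine (integral_pos_iff_support_of_nonneg_ae
      (by filter_upwards [levy_ae_pos hν] with s hs using (hpos s hs).le) (hi2.sub hi1)).2 ?_
    have hsup : Set.Ioi (0:ℝ) ⊆ Function.support
        fun s => (1 - Real.exp (-(l' * s))) - (1 - Real.exp (-(l * s))) :=
      fun s hs => (hpos s hs).ne'
    refine lt_of_lt_of_le ?_ (measure_mono hsup)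
    rw [pos_iff_ne_zero]
    intro h0
    apply hne
    rw [← Measure.measure_univ_eq_zero, ← Set.Iic_union_Ioi (a := (0:ℝ))]
    exact measure_union_null hν.supp h0
  rw [integral_sub hi2 hi1] at h
  exact sub_pos.1 h

lemma sandwich {μ : Measure ℝ} {p : ℝ → ℝ} (hp0 : ∀ s, 0 ≤ p s) (hpm : Measurable p) {L U : ℝ}
    (hU : 0 ≤ U) (h1 : ENNReal.ofReal L ≤ ∫⁻ s, ENNReal.ofReal (p s) ∂μ)
    (h2 : ∫⁻ s, ENNReal.ofReal (p s) ∂μ ≤ ENNReal.ofReal U) :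
    L ≤ ∫ s, p s ∂μ ∧ ∫ s, p s ∂μ ≤ U := by
  rw [integral_eq_lintegral_of_nonneg_ae (Filter.Eventually.of_forall hp0)
    hpm.aestronglyMeasurable]
  exact ⟨(ENNReal.ofReal_le_iff_le_toReal (h2.trans_lt ENNReal.ofReal_lt_top).ne).1 h1,
    ENNReal.toReal_le_of_le_ofReal hU h2⟩

lemma final_const {C κ U X q : ℝ} (hκ : 0 < κ) (hC : κ⁻¹ ≤ C) (hU : U ≤ C) (hX : 0 ≤ X)
    (h : κ * X ≤ q ∧ q ≤ U * X) : C⁻¹ * X ≤ q ∧ q ≤ C * X := by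
  refine ⟨le_trans ?_ h.1, h.2.trans (by gcongr)⟩
  gcongr
  exact inv_le_of_inv_le₀ hκ hC

open MeasureTheory Real Set
open scoped ENNReal

set_option maxHeartbeats 1000000

/-- Corollary 4.4(i)(2): simplified off-diagonal estimates when β₂ < 1 and Φ ≃ Ψ
on (0,R₁), under (Poly-R₁) and HK^h_B. -/
theorem simplified_offdiagonal_estimates_bounded
    {E : Type*} [MetricSpace E] [MeasurableSpace E] [BorelSpace E] [ProperSpace E]
    [TopologicalSpace.SeparableSpace E]
    (m : Measure E) (R_E : ℝ≥0∞) (d₁ d₂ : ℝ)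
    (hm : ∀ (x : E) (r : ℝ), 0 < r → 0 < m (Metric.ball x r) ∧ m (Metric.ball x r) < ⊤)
    (hRE : 0 < R_E) (hd₁ : 0 < d₁) (hd : d₁ ≤ d₂) (hVD : VolDoubling m R_E d₁ d₂)
    (D : Set E) (hDopen : IsOpen D) (hDne : D.Nonempty) (hDproper : D ≠ Set.univ)
    (Φ Ψ : ℝ → ℝ) (cA cA' α₁ α₂ cB cB' α₃ α₄ : ℝ)
    (hΦ0 : Φ 0 = 0) (hΦmono : StrictMonoOn Φ (Set.Ici 0))
    (hΨ0 : Ψ 0 = 0) (hΨmono : StrictMonoOn Ψ (Set.Ici 0))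
    (hΦΨ : ∀ r : ℝ, 0 ≤ r → Φ r ≤ Ψ r)
    (hcA : 0 < cA) (hcA' : 0 < cA') (hα₁ : 0 < α₁) (hα₁₂ : α₁ ≤ α₂)
    (hcB : 0 < cB) (hcB' : 0 < cB') (hα₃ : 0 < α₃) (hα₃₄ : α₃ ≤ α₄)
    (hΦsc : WeakScaling Φ cA cA' α₁ α₂) (hΨsc : WeakScaling Ψ cB cB' α₃ α₄)
    (ΦInv : ℝ → ℝ) (hΦInv : ∀ s : ℝ, 0 < s → 0 < ΦInv s ∧ Φ (ΦInv s) = s)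
    (h : ℝ → E → E → ℝ) (cH γ : ℝ) (hcH : 0 < cH) (hγ : 0 ≤ γ)
    (pD : ℝ → E → E → ℝ)
    (hpD_meas : ∀ x y : E, Measurable fun s => pD s x y)
    (hpD_nonneg : ∀ (s : ℝ) (x y : E), 0 ≤ pD s x y)
    (ν : Measure ℝ) (μ : ℝ → Measure ℝ) (hsub : IsSubordinatorLaw ν μ)
    (φInv : ℝ → ℝ) (hφInv : IsPhiInv ν φInv)
    (R₁ : ℝ≥0∞) (cw cw' β₁ β₂ : ℝ) (hR₁ : 0 < R₁)
    (hcw : 0 < cw) (hcw' : 0 < cw') (hβ₁ : 0 < β₁) (hβ : β₁ ≤ β₂)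
    (C₀ cl cexl cu cexu : ℝ) (hC₀ : C₀ = 0 ∨ C₀ = 1)
    (hcl : 0 < cl) (hcexl : 0 < cexl) (hcu : 0 < cu) (hcexu : 0 < cexu)
    (hβ₂ : β₂ < 1)
    (hΦΨcomp : ∃ k : ℝ, 0 < k ∧ ∀ r : ℝ, 0 < r → ENNReal.ofReal r < R₁ → Ψ r ≤ k * Φ r)
    (hpoly : PolyCond ν R₁ cw cw' β₁ β₂)
    (hDbdd : Bornology.IsBounded D)
    (hdiam : ENNReal.ofReal (8 * Φ (Metric.diam D)) < R₁)
    (hbf : IsBoundaryFunction D h (ENNReal.ofReal (4 * Φ (Metric.diam D) + 1)) cH γ)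
    (hHK : HKest m D Ψ ΦInv h pD C₀ cl cexl cu cexu (fun t => t ≤ 1))
    (lamD c₅ c₆ : ℝ) (hlamD : 0 < lamD) (hc₅ : 0 < c₅) (hc₆ : 0 < c₆)
    (hHKlarge : HKlarge D h pD lamD c₅ c₆) :
    ∀ T : ℝ, 0 < T → ∃ C : ℝ, 1 ≤ C ∧
      ∀ (t : ℝ) (x y : E), 0 < t → t ≤ T → x ∈ D → y ∈ D →
        t ≤ psiFun ν Φ (dist x y) →
        (C₀ = 0 →
          C⁻¹ * (t / vol m x (dist x y) *
              (h (Φ (dist x y)) x y / psiFun ν Φ (dist x y))) ≤ subq μ pD t x y ∧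
            subq μ pD t x y ≤ C * (t / vol m x (dist x y) *
              (h (Φ (dist x y)) x y / psiFun ν Φ (dist x y)))) ∧
        (C₀ = 1 →
          C⁻¹ * (t / vol m x (dist x y) *
              (sB ν h Φ φInv t x y / Φ (dist x y))) ≤ subq μ pD t x y ∧
            subq μ pD t x y ≤ C * (t / vol m x (dist x y) *
              (sB ν h Φ φInv t x y / Φ (dist x y)))) := by
  intro T hT
  have hβ₂0 : 0 < β₂ := hβ₁.trans_le hβ
  have hν := hsub.levy
  have hC₀0 : 0 ≤ C₀ := by rcases hC₀ with h | h <;> rw [h]; exact zero_le_one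
  obtain ⟨Cu, hCu, HU⟩ := pD_up m R_E d₁ d₂ hm hRE hVD D hDne Φ Ψ cA cA' α₁ α₂ hΦ0 hΦmono hΦΨ
    hcA' hΦsc ΦInv hΦInv h cH γ hcH hγ pD C₀ cl cexl cu cexu hC₀0 hcu hcexu hDbdd hbf hHK
    lamD c₅ c₆ hlamD hc₆ hHKlarge
  obtain ⟨ε, K, k, hε, hε1, hK, hk, Hk⟩ := sub_low hsub hcw hcw' hβ₁ hβ₂0 hβ₂ hpoly
  obtain ⟨cL, hcL, HL⟩ := pD_low m R_E d₁ d₂ hm hRE (hd₁.le.trans hd) hVD D hDne Φ Ψ cA cA' α₁ α₂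
    hΦ0 hΦmono hΦΨ hcA hα₁ hΦsc ΦInv hΦInv h cH γ hcH hγ pD C₀ cl cexl cu cexu hC₀0 hcl hcexl
    hDbdd (psi_le_phi hΦ0 hΦmono hΨmono hR₁ hΦΨcomp (Metric.diam D)) hbf hHK
    lamD c₅ c₆ hlamD hc₅ hHKlarge ε K hε hK
  obtain ⟨C1, hC1, H1⟩ := up1 hsub hφInv hcw hcw' hβ₁ hβ₂0 hβ₂ hpoly hcH hγ
  have hK0 : 0 < K := by linarith
  obtain ⟨hb01, hb1, hb2⟩ := hbf
  have hκ0 : 0 < cL * k := by positivity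
  have hκ1 : 0 < cL * (ε * k / (2 * K)) := by positivity
  have hU0 : 0 < 2 * (Cu * (1 + cH)) := by positivity
  have hU1 : 0 < C1 * Cu := by positivity
  have hi0 := inv_pos.2 hκ0
  have hi1 := inv_pos.2 hκ1
  refine ⟨1 + 2 * (Cu * (1 + cH)) + C1 * Cu + (cL * k)⁻¹ + (cL * (ε * k / (2 * K)))⁻¹,
    by linarith, fun t x y ht _ hx hy htψ => ?_⟩
  have hprob := hsub.prob t ht
  have hr : 0 < dist x y := by
    rcases (dist_nonneg (x := x) (y := y)).eq_or_lt with h0 | h0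
    · rw [← h0] at htψ
      simp [psiFun, hΦ0, laplaceExp] at htψ
      linarith
    · exact h0
  have HU' := HU x y hx hy hr
  have HL' := HL x y hx hy hr
  have hrd : dist x y ≤ Metric.diam D := Metric.dist_le_diam_of_mem hDbdd hx hy
  have hFd : Φ (dist x y) ≤ Φ (Metric.diam D) :=
    hΦmono.monotoneOn (Set.mem_Ici.2 hr.le) (Set.mem_Ici.2 (hr.le.trans hrd)) hrd
  have hF : 0 < Φ (dist x y) := phi_pos hΦ0 hΦmono hr
  have hV : 0 < vol m x (dist x y) := vol_pos hm x hr
  unfold psiFun at htψ ⊢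
  unfold subq sB
  set F := Φ (dist x y) with hFdef
  set V := vol m x (dist x y) with hVdef
  have hlap : 0 < laplaceExp ν F⁻¹ := inv_pos.1 (ht.trans_le htψ)
  have htl : t * laplaceExp ν F⁻¹ ≤ 1 := by
    calc t * laplaceExp ν F⁻¹ ≤ (laplaceExp ν F⁻¹)⁻¹ * laplaceExp ν F⁻¹ := by gcongr
      _ = 1 := inv_mul_cancel₀ hlap.ne'
  have hFR : ENNReal.ofReal (4 * F) < R₁ :=
    (ENNReal.ofReal_le_ofReal (by linarith)).trans_lt hdiam
  have hFR' : ENNReal.ofReal F < R₁ :=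
    (ENNReal.ofReal_le_ofReal (by linarith)).trans_lt hFR
  obtain ⟨hφ0, hφ1⟩ := hφInv t⁻¹ (inv_pos.2 ht)
  have hH2 : ∀ s u, 0 < s → s ≤ u → u ≤ 4 * F → s ^ γ * h s x y ≤ cH * (u ^ γ * h u x y) := by
    intro s u hs hsu hu
    refine hb2 x y hx hy s u hs hsu ?_
    exact (ENNReal.ofReal_lt_ofReal_iff (by linarith)).2 (by linarith)
  have hhF := hb01 F x y hF hx hy
  have hpm := hpD_meas x y
  have hp0 : ∀ s, 0 ≤ pD s x y := fun s => hpD_nonneg s x y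
  constructor
  · intro hC0
    rw [div_inv_eq_mul]
    have hX : 0 ≤ t / V * (h F x y * laplaceExp ν F⁻¹) := by
      have := hhF.1
      positivity
    refine final_const hκ0 (by linarith) (U := 2 * (Cu * (1 + cH))) (by linarith) hX ?_
    have hhF0 := hhF.1
    have hlow : ENNReal.ofReal (cL / V * h F x y * (μ t).real (Set.Icc (ε * F) (K * F))) ≤
        ∫⁻ s, ENNReal.ofReal (pD s x y) ∂(μ t) := by
      refine low0 (by positivity) fun s hs => ?_
      have := HL' F s hF (by linarith) hs.1 hs.2 (Or.inr rfl)
      rwa [div_self hF.ne', mul_one] at this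
    have hup := up0 hsub hφInv ht hF (A := Cu * (1 + cH) / V * h F x y) (by positivity)
      (p := fun s => pD s x y) (fun s hs => by
        rcases le_or_gt s F with hsF | hsF
        · have h1 := (HU' s hs).1 hsF
          rw [hC0, zero_mul, zero_add] at h1
          have hm1 : min 1 (s / F) = s / F := min_eq_right (by rw [div_le_one hF]; exact hsF)
          rw [hm1]
          have hh := hH2 s F hs hsF (by linarith)
          have hFp : 0 < F ^ γ := by positivity
          have h2 : h s x y * (s / F) ^ (γ + 1) ≤ cH * h F x y * (s / F) := by
            rw [Real.rpow_add (by positivity), Real.rpow_one, ← mul_assoc]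
            refine mul_le_mul_of_nonneg_right ?_ (by positivity)
            rw [Real.div_rpow hs.le hF.le, ← mul_div_assoc, div_le_iff₀ hFp]
            linarith
          have h3 : cH * h F x y * (s / F) ≤ (1 + cH) * h F x y * (s / F) := by
            gcongr
            linarith
          calc pD s x y ≤ Cu / V * (h s x y * (s / F) ^ (γ + 1)) := h1
            _ ≤ Cu / V * ((1 + cH) * h F x y * (s / F)) := by
              exact mul_le_mul_of_nonneg_left (h2.trans h3) (by positivity)
            _ = _ := by ring
        · have hm1 : min 1 (s / F) = 1 := min_eq_left (by rw [one_le_div hF]; exact hsF.le)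
          rw [hm1, mul_one]
          refine ((HU' s hs).2 hsF).trans ?_
          gcongr
          nlinarith)
    have hs := sandwich hp0 hpm (by positivity) hlow hup
    refine ⟨le_trans ?_ hs.1, hs.2.trans (le_of_eq ?_)⟩
    · have := Hk t F ht hF hFR' htl
      calc cL * k * (t / V * (h F x y * laplaceExp ν F⁻¹))
          = cL / V * h F x y * (k * (t * laplaceExp ν F⁻¹)) := by ring
        _ ≤ _ := by gcongr
    · ring
  · intro hC1'
    set a := (φInv t⁻¹)⁻¹ with ha
    have ha0 : 0 < a := inv_pos.2 hφ0
    have hta : t * laplaceExp ν a⁻¹ = 1 := by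
      rw [ha, inv_inv, hφ1, mul_inv_cancel₀ ht.ne']
    have haF : a ≤ F := by
      by_contra! hcon
      have h1 := lap_strict hν (poly_pos hcw hpoly hF hFR') (inv_pos.2 ha0).le
        (inv_strictAnti₀ hF hcon)
      have h2 := mul_lt_mul_of_pos_left h1 ht
      linarith
    let g : ℝ → ℝ := fun s => if s ≤ 0 then 1 else h s x y
    have hgh : ∀ s, 0 < s → g s = h s x y := fun s hs => if_neg (not_le.2 hs)
    have hg01 : ∀ s, g s ∈ Set.Icc (0:ℝ) 1 := fun s => by
      rcases le_or_gt s 0 with hs | hs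
      · have : g s = 1 := if_pos hs
        rw [this]; exact ⟨zero_le_one, le_rfl⟩
      · rw [hgh s hs]; exact hb01 s x y hs hx hy
    have hg : Antitone g := fun s u hsu => by
      rcases le_or_gt s 0 with hs | hs
      · have : g s = 1 := if_pos hs
        rw [this]; exact (hg01 u).2
      · rw [hgh s hs, hgh u (hs.trans_le hsu)]
        exact hb1 x y hx hy s u hs hsu
    have hg0 : ∀ s, 0 ≤ g s := fun s => (hg01 s).1
    have hg1 : ∀ s, g s ≤ 1 := fun s => (hg01 s).2
    have hB : ∫ s in Set.Ioc (2 * a) (4 * F), h s x y * levyTail ν s = Bint ν g a F := by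
      unfold Bint
      refine setIntegral_congr_fun measurableSet_Ioc fun s hs => ?_
      have hs0 : 0 < s := lt_trans (by positivity) hs.1
      simp only [hgh s hs0]
    rw [hB]
    have hB0 : 0 ≤ Bint ν g a F :=
      integral_nonneg fun s => mul_nonneg (hg0 s) (tail_nonneg s)
    have hX : 0 ≤ t / V * (Bint ν g a F / F) := by positivity
    refine final_const hκ1 (by linarith) (U := C1 * Cu) (by linarith) hX ?_
    have hup := H1 g (fun s => pD s x y) t a F (Cu / V) hg hg0 hg1 ht (by positivity) ha0 haF hFR
      hta (fun s u hs hsu hu => by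
        rw [hgh s hs, hgh u (hs.trans_le hsu)]; exact hH2 s u hs hsu hu)
      (fun s hs hsF => by
        refine ((HU' s hs).1 hsF).trans ?_
        rw [hC1', one_mul, hgh s hs]
        have hh0 := (hb01 s x y hs hx hy).1
        have h1 : (s / F) ^ (γ + 1) ≤ s / F := by
          have := Real.rpow_le_rpow_of_exponent_ge (x := s / F) (by positivity)
            (by rw [div_le_one hF]; exact hsF) (show (1:ℝ) ≤ γ + 1 by linarith)
          rwa [Real.rpow_one] at this
        gcongr
        linarith)
      (fun s hs => by rw [hgh F hF]; exact (HU' s (hF.trans hs)).2 hs)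
    have hlow := low1 hsub hε hK hk Hk g (fun s => pD s x y) t a F (cL / V) hg hg0 hg1 ht
      (by positivity) ha0 hF hFR hta hp0 hpm (fun u s hu hu4 h1 h2 => by
        rw [hgh u hu]; exact HL' u s hu hu4 h1 h2 (Or.inl hC1'))
    have hs := sandwich hp0 hpm (by positivity) hlow hup
    refine ⟨le_trans (le_of_eq ?_) hs.1, hs.2.trans (le_of_eq ?_)⟩
    · ring
    · ring
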